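/- Let G be a separated single-crossing topological multigraph on n ≥ 1 vertices with e edges and crossing number cr(G), and let Δ = ⌈2e/n⌉. Then there exists a separated single-crossing topological multigraph G' with at most 2n vertices, exactly e edges, crossing number cr(G') = cr(G), and maximum vertex degree at most Δ. -/

import Mathlib

open Set

/-- A topological multigraph: a finite vertex set `V ⊂ ℝ²` together with a finite family of
edges, each represented by a continuous injective arc `[0,1] → ℝ²` whose endpoints are two
distinct vertices and whose interior avoids all vertices. -/
structure TopMultigraph where
  V : Finset (ℝ × ℝ)
  ι : Type
  fintype_ι : Fintype ι
  arc : ι → unitInterval → ℝ × ℝ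
  continuous_arc : ∀ e, Continuous (arc e)
  injective_arc : ∀ e, Function.Injective (arc e)
  source_mem : ∀ e, arc e 0 ∈ V
  target_mem : ∀ e, arc e 1 ∈ V
  ends_ne : ∀ e, arc e 0 ≠ arc e 1
  interior_avoids : ∀ e (t : unitInterval), t ≠ 0 → t ≠ 1 → arc e t ∉ V

namespace TopMultigraph

variable (G : TopMultigraph)

instance : Fintype G.ι := G.fintype_ι

/-- The number of edges of `G`. -/
noncomputable def edgeCount : ℕ := Nat.card G.ι

/-- The interior of an edge: the image of the open interval `(0,1)`. -/
def arcInterior (e : G.ι) : Set (ℝ × ℝ) :=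
  G.arc e '' {t : unitInterval | t ≠ 0 ∧ t ≠ 1}

/-- The set of the two endpoints of an edge. -/
def endpoints (e : G.ι) : Set (ℝ × ℝ) := {G.arc e 0, G.arc e 1}

/-- Two distinct edges are parallel if they join the same pair of vertices. -/
def Parallel (e f : G.ι) : Prop := e ≠ f ∧ G.endpoints e = G.endpoints f

/-- Two edges are independent if they share no endpoint. -/
def Independent (e f : G.ι) : Prop := Disjoint (G.endpoints e) (G.endpoints f)

/-- Two edges cross if their open arcs share a common point. -/
def Cross (e f : G.ι) : Prop := (G.arcInterior e ∩ G.arcInterior f).Nonempty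

/-- `G` is single-crossing if any two distinct edges share at most one common interior point. -/
def SingleCrossing : Prop :=
  ∀ e f : G.ι, e ≠ f → (G.arcInterior e ∩ G.arcInterior f).Subsingleton

/-- An edge `e` joins `u` and `v` if its endpoint set is `{u, v}`. -/
def Joins (e : G.ι) (u v : ℝ × ℝ) : Prop := G.endpoints e = {u, v}

/-- The union of the images of all edges of `G` joining `u` and `v`. -/
def pairUnion (u v : ℝ × ℝ) : Set (ℝ × ℝ) :=
  ⋃ e ∈ {e : G.ι | G.Joins e u v}, Set.range (G.arc e)

/-- `ℓ` is a lens of `G` at the pair `{u, v}`: `u ≠ v` are joined by at least one edge, no two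
of the parallel edges joining them cross, and `ℓ` is a bounded connected component of the
complement of the union of the edges joining `u` and `v`. -/
def IsLensAt (u v : ℝ × ℝ) (ℓ : Set (ℝ × ℝ)) : Prop :=
  u ≠ v ∧ (∃ e, G.Joins e u v) ∧
  (∀ e f : G.ι, G.Joins e u v → G.Joins f u v → e ≠ f → ¬ G.Cross e f) ∧
  Bornology.IsBounded ℓ ∧
  ∃ x ∈ (G.pairUnion u v)ᶜ, ℓ = connectedComponentIn (G.pairUnion u v)ᶜ x

/-- `ℓ` is a lens of `G`. -/
def IsLens (ℓ : Set (ℝ × ℝ)) : Prop := ∃ u v, G.IsLensAt u v ℓ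

/-- `L(G)`: the set of all lenses of `G`. -/
def lenses : Set (Set (ℝ × ℝ)) := {ℓ | G.IsLens ℓ}

/-- No two parallel edges of `G` cross. -/
def ParallelNoncrossing : Prop := ∀ e f : G.ι, G.Parallel e f → ¬ G.Cross e f

/-- `G` is separated: no two parallel edges cross and every lens contains a vertex. -/
def Separated : Prop :=
  G.ParallelNoncrossing ∧ ∀ ℓ, G.IsLens ℓ → ∃ v ∈ G.V, v ∈ ℓ

/-- The crossing number of `G`: the number of unordered pairs of distinct edges that cross. -/
noncomputable def crossingNumber : ℕ :=
  Nat.card {p : Sym2 G.ι // ¬ p.IsDiag ∧ ∀ e ∈ p, ∀ f ∈ p, e ≠ f → G.Cross e f}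

/-- The degree of a vertex: the number of edges incident to it. -/
noncomputable def degree (v : ℝ × ℝ) : ℕ :=
  Nat.card {e : G.ι // v ∈ G.endpoints e}

end TopMultigraph



namespace SplitAux

/-- Identification of the plane with `ℂ`. -/
noncomputable def cx (z : ℝ × ℝ) : ℂ := ⟨z.1, z.2⟩

theorem continuous_cx : Continuous cx :=
  Complex.equivRealProdCLM.symm.continuous

theorem cx_injective : Function.Injective cx := by
  intro a b h
  have h1 := congrArg Complex.re h
  have h2 := congrArg Complex.im h
  exact Prod.ext h1 h2

theorem cx_sub_ne {a b : ℝ × ℝ} (h : a ≠ b) : cx a - cx b ≠ 0 :=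
  sub_ne_zero.2 fun h' => h (cx_injective h')

/-- `g` has a continuous logarithm on `X`. -/
def HasLog (X : Set (ℝ × ℝ)) (g : ℝ × ℝ → ℂ) : Prop :=
  ∃ φ : ℝ × ℝ → ℂ, ContinuousOn φ X ∧ ∀ z ∈ X, Complex.exp (φ z) = g z

theorem HasLog.mono {X Y : Set (ℝ × ℝ)} {g : ℝ × ℝ → ℂ} (h : HasLog X g) (hY : Y ⊆ X) :
    HasLog Y g := by
  obtain ⟨φ, h1, h2⟩ := h
  exact ⟨φ, h1.mono hY, fun z hz => h2 z (hY hz)⟩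

theorem HasLog.mul {X : Set (ℝ × ℝ)} {g h : ℝ × ℝ → ℂ} (hg : HasLog X g) (hh : HasLog X h) :
    HasLog X (fun z => g z * h z) := by
  obtain ⟨φ, h1, h2⟩ := hg
  obtain ⟨ψ, h3, h4⟩ := hh
  exact ⟨fun z => φ z + ψ z, h1.add h3, fun z hz => by rw [Complex.exp_add, h2 z hz, h4 z hz]⟩

theorem HasLog.inv {X : Set (ℝ × ℝ)} {g : ℝ × ℝ → ℂ} (hg : HasLog X g) :
    HasLog X (fun z => (g z)⁻¹) := by
  obtain ⟨φ, h1, h2⟩ := hg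
  exact ⟨fun z => - φ z, h1.neg, fun z hz => by rw [Complex.exp_neg, h2 z hz]⟩

theorem HasLog.congr {X : Set (ℝ × ℝ)} {g h : ℝ × ℝ → ℂ} (hg : HasLog X g)
    (hh : ∀ z ∈ X, g z = h z) : HasLog X h := by
  obtain ⟨φ, h1, h2⟩ := hg
  exact ⟨φ, h1, fun z hz => by rw [h2 z hz, hh z hz]⟩

/-- logarithms exist on simply connected spaces. -/
theorem exists_log {A : Type*} [TopologicalSpace A] [SimplyConnectedSpace A]
    [LocallyPathConnectedSpace A] (f : A → ℂ) (hf : Continuous f) (h0 : ∀ a, f a ≠ 0) :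
    ∃ φ : A → ℂ, Continuous φ ∧ ∀ a, Complex.exp (φ a) = f a := by
  obtain ⟨a₀⟩ : Nonempty A := inferInstance
  obtain ⟨F, ⟨-, hF⟩, -⟩ := Complex.isCoveringMapOn_exp.existsUnique_continuousMap_lifts
    (⟨f, hf⟩ : C(A, ℂ)) (a₀ := a₀) (e₀ := Complex.log (f a₀)) (Complex.exp_log (h0 a₀))
    (fun a => h0 a)
  exact ⟨F, F.continuous, fun a => congrFun hF a⟩

theorem exp_const {A : Type*} [TopologicalSpace A] {S : Set A} (hS : IsPreconnected S)
    {ψ : A → ℂ} (hc : ContinuousOn ψ S) (h1 : ∀ z ∈ S, Complex.exp (ψ z) = 1)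
    {a b : A} (ha : a ∈ S) (hb : b ∈ S) : ψ a = ψ b := by
  have key : ∀ z ∈ S, ∃ n : ℤ, ψ z = n * (2 * Real.pi * Complex.I) := fun z hz =>
    Complex.exp_eq_one_iff.1 (h1 z hz)
  have hpi : (2 * Real.pi * Complex.I : ℂ) ≠ 0 := Complex.two_pi_I_ne_zero
  have hd : IsDiscrete (range (Int.cast : ℤ → ℝ)) :=
    isDiscrete_iff_discreteTopology.2 (Int.isClosedEmbedding_coe_real.isEmbedding.toHomeomorph.symm.isEmbedding.discreteTopology)
  have := hS.constant_of_mapsTo hd (f := fun z => (ψ z / (2 * Real.pi * Complex.I)).re)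
    (Complex.continuous_re.comp_continuousOn (hc.div_const _)) (by
      intro z hz
      obtain ⟨n, hn⟩ := key z hz
      refine ⟨n, ?_⟩
      simp only [hn, mul_div_cancel_right₀ _ hpi]
      simp) ha hb
  obtain ⟨n, hn⟩ := key a ha
  obtain ⟨m, hm⟩ := key b hb
  simp only [hn, hm, mul_div_cancel_right₀ _ hpi] at this
  simp at this
  rw [hn, hm, this]

/-- No nonvanishing function on the plane equals `z - x` far away. -/
theorem no_extension (F : ℝ × ℝ → ℂ) (hF : Continuous F) (h0 : ∀ z, F z ≠ 0) (x : ℝ × ℝ)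
    (M : ℝ) (hM : 0 < M) (h : ∀ z, ‖cx z - cx x‖ = M → F z = cx z - cx x) : False := by
  obtain ⟨φ, hφ, he⟩ := exists_log F hF h0
  let p : ℝ → ℝ × ℝ := fun θ => (x.1 + M * Real.cos θ, x.2 + M * Real.sin θ)
  have hp : Continuous p := by fun_prop
  have hpx : ∀ θ, cx (p θ) - cx x = M * Complex.exp (θ * Complex.I) := by
    intro θ
    rw [Complex.exp_mul_I]
    apply Complex.ext <;>
    simp [p, cx, Complex.cos_ofReal_re, Complex.sin_ofReal_re, Complex.cos_ofReal_im]
  have hn : ∀ θ, ‖cx (p θ) - cx x‖ = M := by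
    intro θ
    rw [hpx, norm_mul, Complex.norm_exp_ofReal_mul_I]; simp [hM.le]
  have hM' : (M : ℂ) ≠ 0 := by exact_mod_cast hM.ne'
  have := exp_const (S := (univ : Set ℝ)) isPreconnected_univ
    (ψ := fun θ : ℝ => φ (p θ) - θ * Complex.I - Complex.log M)
    (by apply Continuous.continuousOn; fun_prop)
    (by
      intro θ _
      rw [Complex.exp_sub, Complex.exp_sub, he, h _ (hn θ), hpx, Complex.exp_log hM']
      field_simp [Complex.exp_ne_zero])
    (mem_univ 0) (mem_univ (2 * Real.pi))
  have hpp : p 0 = p (2 * Real.pi) := by simp [p]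
  simp only [hpp] at this
  have h2 : (2 * Real.pi * Complex.I : ℂ) ≠ 0 := Complex.two_pi_I_ne_zero
  apply h2
  simp at this
  linear_combination this

/-- Eilenberg criterion, hard direction. -/
theorem no_log_frontier {C : Set (ℝ × ℝ)} (hCb : Bornology.IsBounded C)
    {x : ℝ × ℝ} (hx : x ∈ C) (h : ℝ × ℝ → ℂ) (hc : Continuous h) (h0 : ∀ z ∈ closure C, h z ≠ 0)
    (hl : HasLog (frontier C) (fun z => (cx z - cx x) * (h z)⁻¹)) : False := by
  classical
  obtain ⟨φ, hφ, he⟩ := hl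
  obtain ⟨g, hg⟩ := ContinuousMap.exists_restrict_eq (Y := ℂ) (isClosed_frontier (s := C))
    ⟨(frontier C).domRestrict φ, continuousOn_iff_continuous_domRestrict.1 hφ⟩
  have hgφ : ∀ z ∈ frontier C, g z = φ z := fun z hz => by
    have := DFunLike.congr_fun hg ⟨z, hz⟩
    simpa using this
  let F : ℝ × ℝ → ℂ := fun z => if z ∈ C then Complex.exp (g z) * h z else cx z - cx x
  have hF : Continuous F := by
    apply Continuous.if
    · intro z hz
      have hz' : z ∈ frontier C := hz
      rw [hgφ z hz', he z hz', inv_mul_cancel_right₀ (h0 z (frontier_subset_closure hz'))]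
    · exact (Complex.continuous_exp.comp g.continuous).mul hc
    · exact continuous_cx.sub continuous_const
  have hF0 : ∀ z, F z ≠ 0 := by
    intro z
    by_cases hz : z ∈ C
    · simp only [F, hz, if_true]
      exact mul_ne_zero (Complex.exp_ne_zero _) (h0 z (subset_closure hz))
    · simp only [F, hz, if_false]
      exact cx_sub_ne fun h => hz (h ▸ hx)
  have hb : Bornology.IsBounded (cx '' C) := by
    obtain ⟨R, hR⟩ := hCb.subset_closedBall 0
    have : IsCompact (cx '' Metric.closedBall 0 R) := (isCompact_closedBall _ _).image continuous_cx
    exact this.isBounded.subset (image_mono hR)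
  obtain ⟨M, hM⟩ := hb.subset_ball (cx x)
  have hMpos : 0 < M := by
    have := hM (mem_image_of_mem cx hx)
    simpa using this
  refine no_extension F hF hF0 x M hMpos ?_
  intro z hz
  have : z ∉ C := by
    intro hzC
    have := hM (mem_image_of_mem cx hzC)
    rw [mem_ball_iff_norm] at this
    exact absurd hz this.ne
  simp [F, this]

theorem one_add_slit {w : ℂ} (h : ‖w‖ < 1) : 1 + w ∈ Complex.slitPlane :=
  Complex.mem_slitPlane_of_norm_lt_one h

theorem hasLog_of_near {X : Set (ℝ × ℝ)} {g : ℝ × ℝ → ℂ} (hg : ContinuousOn g X)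
    (h : ∀ z ∈ X, ‖g z - 1‖ < 1) : HasLog X g := by
  have hs : ∀ z ∈ X, g z ∈ Complex.slitPlane := fun z hz => by
    have := one_add_slit (h z hz)
    simpa using this
  exact ⟨fun z => Complex.log (g z), hg.clog hs, fun z hz =>
    Complex.exp_log (Complex.slitPlane_ne_zero (hs z hz))⟩

/-- `z - x` has a logarithm on discs not containing `x`. -/
theorem hasLog_disc {D : Set (ℝ × ℝ)} {v x : ℝ × ℝ}
    (hD : ∀ z ∈ D, ‖cx z - cx v‖ < ‖cx x - cx v‖) : HasLog D (fun z => cx z - cx x) := by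
  by_cases hx : cx v - cx x = 0
  · have : D = ∅ := by
      ext z
      simp only [mem_empty_iff_false, iff_false]
      intro hz
      have := hD z hz
      rw [norm_sub_rev (cx x), hx, norm_zero] at this
      exact absurd this (not_lt.2 (norm_nonneg _))
    subst this
    exact ⟨fun _ => 0, continuousOn_empty _, by simp⟩
  have h1 : HasLog D (fun z => (cx z - cx x) / (cx v - cx x)) := by
    apply hasLog_of_near
    · exact ((continuous_cx.sub continuous_const).div_const _).continuousOn
    · intro z hz
      rw [div_sub_one hx, norm_div, div_lt_one (norm_pos_iff.2 hx)]
      have := hD z hz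
      rw [norm_sub_rev (cx x)] at this
      simpa using this
  have h2 : HasLog D (fun _ => cx v - cx x) :=
    ⟨fun _ => Complex.log (cx v - cx x), continuousOn_const, fun _ _ => Complex.exp_log hx⟩
  exact (h1.mul h2).congr fun z _ => by field_simp

/-- Eilenberg criterion, easy direction. -/
theorem hasLog_of_component {X C : Set (ℝ × ℝ)} (hX : IsCompact X) (hC : IsPreconnected C)
    (hCX : C ⊆ Xᶜ) {x y : ℝ × ℝ} (hx : x ∈ C) (hy : y ∈ C) :
    HasLog X (fun z => (cx z - cx x) * (cx z - cx y)⁻¹) := by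
  have hne : ∀ a ∈ C, ∀ z ∈ X, cx z - cx a ≠ 0 := fun a ha z hz =>
    cx_sub_ne fun h => hCX ha (h ▸ hz)
  refine hC.induction₂ (fun x y => HasLog X (fun z => (cx z - cx x) * (cx z - cx y)⁻¹))
    ?_ ?_ ?_ hx hy
  · intro a ha
    have ho : IsOpen (Xᶜ) := hX.isClosed.isOpen_compl
    obtain ⟨δ, hδ, hball⟩ : ∃ δ > 0, ∀ z ∈ X, δ ≤ ‖cx z - cx a‖ := by
      have hc : IsClosed (cx '' X) := (hX.image continuous_cx).isClosed
      have hna : cx a ∈ (cx '' X)ᶜ := by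
        rintro ⟨z, hz, hza⟩
        exact hCX ha (cx_injective hza ▸ hz)
      obtain ⟨δ, hδ, hb⟩ := Metric.isOpen_iff.1 hc.isOpen_compl _ hna
      refine ⟨δ, hδ, fun z hz => ?_⟩
      by_contra hlt
      push Not at hlt
      exact hb (mem_ball_iff_norm.2 hlt) ⟨z, hz, rfl⟩
    have hev : ∀ᶠ b in nhdsWithin a C, ‖cx b - cx a‖ < δ := by
      apply Filter.Eventually.filter_mono nhdsWithin_le_nhds
      have : Filter.Tendsto (fun b => ‖cx b - cx a‖) (nhds a) (nhds ‖cx a - cx a‖) :=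
        ((continuous_cx.sub continuous_const).norm).tendsto a
      exact this.eventually (gt_mem_nhds (by simpa using hδ))
    filter_upwards [hev, self_mem_nhdsWithin] with b hb hbC
    have h1 : HasLog X (fun z => (cx z - cx b) * (cx z - cx a)⁻¹) := by
      apply hasLog_of_near
      · apply ContinuousOn.mul
        · exact (continuous_cx.sub continuous_const).continuousOn
        · exact (continuous_cx.sub continuous_const).continuousOn.inv₀ (hne a ha)
      · intro z hz
        rw [← div_eq_mul_inv, div_sub_one (hne a ha z hz), norm_div,
          div_lt_one (norm_pos_iff.2 (hne a ha z hz))]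
        have : cx z - cx b - (cx z - cx a) = -(cx b - cx a) := by ring
        rw [this, norm_neg]
        exact hb.trans_le (hball z hz)
    refine h1.inv.congr fun z hz => ?_
    rw [mul_inv, inv_inv, mul_comm]
  · intro a b c _ hb _ h1 h2
    refine (h1.mul h2).congr fun z hz => ?_
    have := hne b hb z hz
    field_simp
  · intro a b _ _ h1
    refine h1.inv.congr fun z hz => ?_
    rw [mul_inv, inv_inv, mul_comm]

theorem hasLog_of_unbounded {X C : Set (ℝ × ℝ)} (hX : IsCompact X) (hC : IsPreconnected C)
    (hCX : C ⊆ Xᶜ) (hCb : ¬ Bornology.IsBounded C) {x : ℝ × ℝ} (hx : x ∈ C) :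
    HasLog X (fun z => cx z - cx x) := by
  obtain ⟨M, hM⟩ := (hX.image continuous_cx).isBounded.subset_ball 0
  obtain ⟨y, hy, hyM⟩ : ∃ y ∈ C, M ≤ ‖cx y‖ := by
    by_contra hcon
    push Not at hcon
    apply hCb
    rw [isBounded_iff_forall_norm_le]
    refine ⟨M, fun y hy => ?_⟩
    have h1 := (hcon y hy).le
    have h2 := (Complex.abs_re_le_norm (cx y)).trans h1
    have h3 := (Complex.abs_im_le_norm (cx y)).trans h1
    exact max_le h2 h3
  have h1 := hasLog_of_component hX hC hCX hx hy
  have h0 : cx 0 = 0 := rfl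
  have h2 : HasLog X (fun z => cx z - cx y) := by
    apply hasLog_disc (v := 0)
    intro z hz
    have := hM (mem_image_of_mem cx hz)
    rw [mem_ball_zero_iff] at this
    simpa [h0] using this.trans_le hyM
  refine (h1.mul h2).congr fun z hz => ?_
  have : cx z - cx y ≠ 0 := cx_sub_ne fun h => hCX hy (h ▸ hz)
  field_simp

/-- Gluing logarithms. -/
theorem hasLog_glue {Y T T' D : Set (ℝ × ℝ)} {g : ℝ × ℝ → ℂ} (hY : IsClosed Y)
    (hT' : IsClosed T') (hTc : IsPreconnected T) (hTD : T ⊆ D) (hTD' : T' ⊆ D)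
    (hYT : Y ∩ T' ⊆ T) (hD : HasLog D g) (h : HasLog (Y ∪ T) g) : HasLog (Y ∪ T') g := by
  classical
  obtain ⟨φ, hφ, he⟩ := h
  obtain ⟨l, hl, hle⟩ := hD
  obtain ⟨κ, hκ1, hκ⟩ : ∃ κ : ℂ, Complex.exp κ = 1 ∧ ∀ z ∈ T, φ z = l z + κ := by
    rcases T.eq_empty_or_nonempty with h | ⟨t, ht⟩
    · exact ⟨0, by simp, by simp [h]⟩
    have h1 : ∀ z ∈ T, Complex.exp (φ z - l z) = 1 := fun z hz => by
      rw [Complex.exp_sub, he z (Or.inr hz), hle z (hTD hz), div_self]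
      rw [← hle z (hTD hz)]; exact Complex.exp_ne_zero _
    refine ⟨φ t - l t, h1 t ht, fun z hz => ?_⟩
    have := exp_const hTc (ψ := fun z => φ z - l z)
      ((hφ.mono subset_union_right).sub (hl.mono hTD)) h1 hz ht
    rw [← this]; ring
  refine ⟨fun z => if z ∈ Y then φ z else l z + κ, ?_, ?_⟩
  · apply ContinuousOn.union_of_isClosed _ _ hY hT'
    · exact (hφ.mono subset_union_left).congr fun z hz => by simp [hz]
    · refine ((hl.mono hTD').add (continuousOn_const (c := κ))).congr fun z hz => ?_
      by_cases hzY : z ∈ Y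
      · simp only [hzY, if_true]
        exact hκ z (hYT ⟨hzY, hz⟩)
      · simp [hzY]
  · intro z hz
    by_cases hzY : z ∈ Y
    · simp only [hzY, if_true]
      exact he z (Or.inl hzY)
    · simp only [hzY, if_false]
      have hzT : z ∈ T' := hz.resolve_left hzY
      rw [Complex.exp_add, hκ1, mul_one, hle z (hTD' hzT)]

/-- Logarithms on arcs. -/
theorem hasLog_arc {γ : unitInterval → ℝ × ℝ} (hγ : Continuous γ) (hi : Function.Injective γ)
    {g : ℝ × ℝ → ℂ} (hg : Continuous g) (h0 : ∀ t, g (γ t) ≠ 0) : HasLog (range γ) g := by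
  obtain ⟨φ', hφ', he'⟩ := exists_log (fun t : ℝ => g (γ (projIcc 0 1 zero_le_one t)))
    (hg.comp (hγ.comp continuous_projIcc)) (fun t => h0 _)
  obtain ⟨φ, hφ, he⟩ : ∃ φ : unitInterval → ℂ, Continuous φ ∧ ∀ t, Complex.exp (φ t) = g (γ t) :=
    ⟨fun t => φ' t, hφ'.comp continuous_subtype_val, fun t => by
      rw [he', projIcc_val]⟩
  have hemb := (hγ.isClosedEmbedding hi).isEmbedding
  refine ⟨fun z => φ (Function.invFun γ z), ?_, ?_⟩
  · rw [continuousOn_iff_continuous_domRestrict]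
    have : (range γ).domRestrict (fun z => φ (Function.invFun γ z))
        = φ ∘ hemb.toHomeomorph.symm := by
      ext ⟨z, t, rfl⟩
      have : hemb.toHomeomorph.symm ⟨γ t, t, rfl⟩ = t := by
        rw [Homeomorph.symm_apply_eq]; rfl
      simp [Set.domRestrict, Function.leftInverse_invFun hi t, this]
    rw [this]
    exact hφ.comp hemb.toHomeomorph.symm.continuous
  · rintro _ ⟨t, rfl⟩
    simp only [Function.leftInverse_invFun hi t, he]

/-- Logarithms on trees (unions of sets meeting in a single point). -/
theorem hasLog_tree {ι : Type*} {g : ℝ × ℝ → ℂ} (J : Set ι) (hJ : J.Finite)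
    (A : ι → Set (ℝ × ℝ)) (w : ℝ × ℝ) (hgw : g w ≠ 0) (hA : ∀ i ∈ J, IsClosed (A i))
    (hw : ∀ i ∈ J, w ∈ A i) (hl : ∀ i ∈ J, HasLog (A i) g)
    (hd : ∀ i ∈ J, ∀ j ∈ J, i ≠ j → A i ∩ A j ⊆ {w}) :
    HasLog ({w} ∪ ⋃ i ∈ J, A i) g := by
  induction J, hJ using Set.Finite.induction_on with
  | empty =>
    refine ⟨fun _ => Complex.log (g w), continuousOn_const, ?_⟩
    intro z hz
    have : z = w := by simpa using hz
    rw [this, Complex.exp_log hgw]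
  | @insert a s ha hs ih =>
    have ih' := ih (fun i hi => hA i (mem_insert_of_mem a hi))
      (fun i hi => hw i (mem_insert_of_mem a hi)) (fun i hi => hl i (mem_insert_of_mem a hi))
      (fun i hi j hj => hd i (mem_insert_of_mem a hi) j (mem_insert_of_mem a hj))
    have hwa := hw a (mem_insert a s)
    have hcl : IsClosed ({w} ∪ ⋃ i ∈ s, A i) :=
      isClosed_singleton.union (hs.isClosed_biUnion fun i hi => hA i (mem_insert_of_mem a hi))
    have := hasLog_glue (T := {w}) (T' := A a) (D := A a) hcl (hA a (mem_insert a s))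
      isPreconnected_singleton (by simpa using hwa) subset_rfl (by
        rintro z ⟨hz | hz, hz'⟩
        · exact hz
        · simp only [mem_iUnion] at hz
          obtain ⟨i, hi, hz⟩ := hz
          exact hd i (mem_insert_of_mem a hi) a (mem_insert a s) (fun h => ha (h ▸ hi)) ⟨hz, hz'⟩)
      (hl a (mem_insert a s)) (ih'.mono (by
        intro z hz
        rcases hz with hz | hz
        · exact hz
        · exact Or.inl hz))
    refine this.mono ?_
    rw [biUnion_insert]
    intro z hz
    rcases hz with hz | hz | hz
    · exact Or.inl (Or.inl hz)
    · exact Or.inr hz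
    · exact Or.inl (Or.inr hz)

/-- An arc has empty interior. -/
theorem arc_interior_empty {γ : unitInterval → ℝ × ℝ} (hγ : Continuous γ)
    (hi : Function.Injective γ) : interior (range γ) = ∅ := by
  by_contra hne
  obtain ⟨x, hx⟩ := nonempty_iff_ne_empty.2 hne
  obtain ⟨r, hr, hb⟩ := Metric.isOpen_iff.1 isOpen_interior x hx
  have hb' : Metric.ball x r ⊆ range γ := hb.trans interior_subset
  have hcl : IsClosedMap γ := hγ.isClosedMap
  have key : ∀ p q : ℝ × ℝ, q ∈ Metric.ball x r → p ∉ segment ℝ x q → ∀ t0 t1 t2, γ t0 = x →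
      γ t1 = p → γ t2 = q → ¬ (t0 < t1 ∧ t1 < t2) ∧ ¬ (t2 < t1 ∧ t1 < t0) := by
    intro p q hq hp t0 t1 t2 h0 h1 h2
    have hpre : IsPreconnected (γ ⁻¹' segment ℝ x q) :=
      (convex_segment x q).isPreconnected.preimage_of_isClosedMap hi hcl
        (((convex_ball x r).segment_subset (Metric.mem_ball_self hr) hq).trans hb')
    have m0 : t0 ∈ γ ⁻¹' segment ℝ x q := by simp [h0, left_mem_segment]
    have m2 : t2 ∈ γ ⁻¹' segment ℝ x q := by simp [h2, right_mem_segment]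
    refine ⟨fun h => hp ?_, fun h => hp ?_⟩
    · have := hpre.Icc_subset m0 m2 ⟨h.1.le, h.2.le⟩
      rwa [mem_preimage, h1] at this
    · have := hpre.Icc_subset m2 m0 ⟨h.1.le, h.2.le⟩
      rwa [mem_preimage, h1] at this
  have hmem : ∀ d : ℝ × ℝ, ‖d‖ = r / 2 → x + d ∈ Metric.ball x r := by
    intro d hd
    rw [mem_ball_iff_norm, add_sub_cancel_left, hd]; linarith
  have hseg : ∀ d e : ℝ × ℝ, (∀ s : ℝ, 0 ≤ s → d ≠ s • e) → x + d ∉ segment ℝ x (x + e) := by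
    rintro d e h ⟨a, b, ha, hb, hab, hE⟩
    apply h b hb
    have : a • x + b • (x + e) = x + b • e := by
      rw [smul_add, ← add_assoc, ← add_smul, hab, one_smul]
    rw [this] at hE
    exact (add_left_cancel hE).symm
  let d1 : ℝ × ℝ := (r/2, 0)
  let d2 : ℝ × ℝ := (-(r/2), 0)
  let d3 : ℝ × ℝ := (0, r/2)
  have n1 : ‖d1‖ = r/2 := by simp [d1, Prod.norm_def, abs_of_pos hr]; linarith
  have n2 : ‖d2‖ = r/2 := by simp [d2, Prod.norm_def, abs_of_pos hr]; linarith
  have n3 : ‖d3‖ = r/2 := by simp [d3, Prod.norm_def, abs_of_pos hr]; linarith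
  have e12 : ∀ s : ℝ, 0 ≤ s → d1 ≠ s • d2 := by
    intro s hs h
    have := congrArg Prod.fst h
    simp [d1, d2] at this
    nlinarith
  have e21 : ∀ s : ℝ, 0 ≤ s → d2 ≠ s • d1 := by
    intro s hs h
    have := congrArg Prod.fst h
    simp [d1, d2] at this
    nlinarith
  have e13 : ∀ s : ℝ, 0 ≤ s → d1 ≠ s • d3 := by
    intro s hs h
    have := congrArg Prod.fst h
    simp [d1, d3] at this
    linarith
  have e31 : ∀ s : ℝ, 0 ≤ s → d3 ≠ s • d1 := by
    intro s hs h
    have := congrArg Prod.snd h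
    simp [d1, d3] at this
    linarith
  have e23 : ∀ s : ℝ, 0 ≤ s → d2 ≠ s • d3 := by
    intro s hs h
    have := congrArg Prod.fst h
    simp [d2, d3] at this
    linarith
  have e32 : ∀ s : ℝ, 0 ≤ s → d3 ≠ s • d2 := by
    intro s hs h
    have := congrArg Prod.snd h
    simp [d2, d3] at this
    linarith
  obtain ⟨t0, h0⟩ := hb' (Metric.mem_ball_self hr)
  obtain ⟨t1, h1⟩ := hb' (hmem d1 n1)
  obtain ⟨t2, h2⟩ := hb' (hmem d2 n2)
  obtain ⟨t3, h3⟩ := hb' (hmem d3 n3)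
  have k12 := key _ _ (hmem d2 n2) (hseg d1 d2 e12) t0 t1 t2 h0 h1 h2
  have k21 := key _ _ (hmem d1 n1) (hseg d2 d1 e21) t0 t2 t1 h0 h2 h1
  have k13 := key _ _ (hmem d3 n3) (hseg d1 d3 e13) t0 t1 t3 h0 h1 h3
  have k31 := key _ _ (hmem d1 n1) (hseg d3 d1 e31) t0 t3 t1 h0 h3 h1
  have k23 := key _ _ (hmem d3 n3) (hseg d2 d3 e23) t0 t2 t3 h0 h2 h3
  have k32 := key _ _ (hmem d2 n2) (hseg d3 d2 e32) t0 t3 t2 h0 h3 h2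
  have c01 : t0 ≠ t1 := by
    rintro rfl
    rw [h0] at h1
    have : d1 = 0 := by simpa using h1.symm
    rw [this] at n1; simp at n1; linarith
  have c02 : t0 ≠ t2 := by
    rintro rfl
    rw [h0] at h2
    have : d2 = 0 := by simpa using h2.symm
    rw [this] at n2; simp at n2; linarith
  have c03 : t0 ≠ t3 := by
    rintro rfl
    rw [h0] at h3
    have : d3 = 0 := by simpa using h3.symm
    rw [this] at n3; simp at n3; linarith
  have c12 : t1 ≠ t2 := by
    rintro rfl
    rw [h1] at h2
    exact e12 1 zero_le_one (by simpa using h2)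
  have c13 : t1 ≠ t3 := by
    rintro rfl
    rw [h1] at h3
    exact e13 1 zero_le_one (by simpa using h3)
  have c23 : t2 ≠ t3 := by
    rintro rfl
    rw [h2] at h3
    exact e23 1 zero_le_one (by simpa using h3)
  grind

/-- A finite union of arcs has empty interior. -/
theorem arcs_interior_empty {ι : Type*} (J : Set ι) (hJ : J.Finite) (γ : ι → unitInterval → ℝ × ℝ)
    (hγ : ∀ i, Continuous (γ i)) (hi : ∀ i, Function.Injective (γ i)) :
    interior (⋃ i ∈ J, range (γ i)) = ∅ := by
  induction J, hJ using Set.Finite.induction_on with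
  | empty => simp
  | @insert a s _ _ ih =>
    rw [biUnion_insert, interior_union_isClosed_of_interior_empty
      (isCompact_range (hγ a)).isClosed ih]
    exact arc_interior_empty (hγ a) (hi a)

end SplitAux


namespace SplitAux

theorem frontier_component {X : Set (ℝ × ℝ)} (hX : IsClosed X) (x : ℝ × ℝ) :
    frontier (connectedComponentIn Xᶜ x) ⊆ X := by
  intro z hz
  by_contra hzX
  have ho : IsOpen (connectedComponentIn Xᶜ x) := hX.isOpen_compl.connectedComponentIn
  have hoz : IsOpen (connectedComponentIn Xᶜ z) := hX.isOpen_compl.connectedComponentIn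
  have hmem : z ∈ connectedComponentIn Xᶜ z := mem_connectedComponentIn hzX
  obtain ⟨y, hy1, hy2⟩ := mem_closure_iff.1 (frontier_subset_closure hz) _ hoz hmem
  have e1 := connectedComponentIn_eq hy1
  have e2 := connectedComponentIn_eq hy2
  rw [e1, ← e2] at hmem
  have := hz.2
  rw [ho.interior_eq] at this
  exact this hmem

/-- Transfer of lenses under local rerouting of arcs. -/
theorem lens_transfer {ι : Type*} (J : Set ι) (hJ : J.Finite) (γ γ' : ι → unitInterval → ℝ × ℝ)
    (s : ι → unitInterval) (u v w : ℝ × ℝ) (R : ℝ)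
    (hγ : ∀ i ∈ J, Continuous (γ i))
    (hγ' : ∀ i ∈ J, Continuous (γ' i)) (hi' : ∀ i ∈ J, Function.Injective (γ' i))
    (h0 : ∀ i ∈ J, γ i 0 = u) (h1 : ∀ i ∈ J, γ i 1 = v)
    (h1' : ∀ i ∈ J, γ' i 1 = w)
    (hu : R < ‖cx u - cx v‖) (hw : ‖cx w - cx v‖ < R)
    (hs : ∀ i ∈ J, ∀ t ≤ s i, γ' i t = γ i t)
    (hD : ∀ i ∈ J, ∀ t, s i ≤ t → ‖cx (γ i t) - cx v‖ < R)
    (hD' : ∀ i ∈ J, ∀ t, s i ≤ t → ‖cx (γ' i t) - cx v‖ < R)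
    (hd' : ∀ i ∈ J, ∀ j ∈ J, i ≠ j → ∀ a b, γ' i a = γ' j b → (a = 0 ∧ b = 0) ∨ (a = 1 ∧ b = 1))
    (x : ℝ × ℝ) (hx : x ∉ ⋃ i ∈ J, range (γ' i))
    (hb : Bornology.IsBounded (connectedComponentIn (⋃ i ∈ J, range (γ' i))ᶜ x)) :
    ∃ x0, x0 ∉ ⋃ i ∈ J, range (γ i) ∧
      Bornology.IsBounded (connectedComponentIn (⋃ i ∈ J, range (γ i))ᶜ x0) ∧
      ∀ y, R ≤ ‖cx y - cx v‖ → y ∉ ⋃ i ∈ J, range (γ' i) →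
        y ∈ connectedComponentIn (⋃ i ∈ J, range (γ i))ᶜ x0 →
        y ∈ connectedComponentIn (⋃ i ∈ J, range (γ' i))ᶜ x := by
  set X := ⋃ i ∈ J, range (γ i) with hXdef
  set X' := ⋃ i ∈ J, range (γ' i) with hXdef'
  have hX : IsCompact X := hJ.isCompact_biUnion fun i hi => isCompact_range (hγ i hi)
  have hX' : IsCompact X' := hJ.isCompact_biUnion fun i hi => isCompact_range (hγ' i hi)
  set C' := connectedComponentIn X'ᶜ x with hC'
  set D : Set (ℝ × ℝ) := {z | ‖cx z - cx v‖ < R} with hDdef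
  have hCo : IsOpen C' := hX'.isClosed.isOpen_compl.connectedComponentIn
  have hfr : frontier C' ⊆ X' := frontier_component hX'.isClosed x
  have hxC : x ∈ C' := mem_connectedComponentIn hx
  have hC'X : C' ⊆ X'ᶜ := connectedComponentIn_subset _ _
  have hs0 : ∀ i ∈ J, s i ≠ 0 := by
    intro i hi h
    have := hD i hi 0 h.le
    rw [h0 i hi] at this
    linarith
  -- the lens leaves the disc
  obtain ⟨x0, hx0C, hx0D⟩ : ∃ x0 ∈ C', x0 ∉ D := by
    by_contra hcon
    push Not at hcon
    have hCD : C' ⊆ D := hcon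
    have hclosed : IsClosed {z : ℝ × ℝ | ‖cx z - cx v‖ ≤ R} :=
      isClosed_le (continuous_cx.sub continuous_const).norm continuous_const
    have hcl : closure C' ⊆ {z | ‖cx z - cx v‖ ≤ R} :=
      closure_minimal (fun z hz => le_of_lt (show ‖cx z - cx v‖ < R from hCD hz)) hclosed
    have htree := hasLog_tree (g := fun z => cx z - cx x) J hJ
      (fun i => range (γ' i) ∩ {z | ‖cx z - cx v‖ ≤ R}) w
    by_cases hwx : w = x
    · by_cases hne : J.Nonempty
      · obtain ⟨i, hi⟩ := hne
        exact hx (mem_biUnion hi ⟨1, by rw [h1' i hi, hwx]⟩)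
      · rw [not_nonempty_iff_eq_empty] at hne
        have hXe : X' = ∅ := by rw [hXdef', hne]; simp
        refine no_log_frontier hb hxC (fun _ => 1) continuous_const (by simp) ?_
        refine ⟨fun _ => 0, continuousOn_const, fun z hz => ?_⟩
        have := hfr hz
        rw [hXe] at this
        exact this.elim
    have := htree (cx_sub_ne hwx)
      (fun i hi => (isCompact_range (hγ' i hi)).isClosed.inter hclosed)
      (fun i hi => ⟨⟨1, h1' i hi⟩, hw.le⟩)
      (fun i hi => (hasLog_arc (hγ' i hi) (hi' i hi) (continuous_cx.sub continuous_const)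
        (fun t => cx_sub_ne fun h => hx (mem_biUnion hi ⟨t, h⟩))).mono inter_subset_left)
      (by
        rintro i hi j hj hij z ⟨⟨⟨a, rfl⟩, ha⟩, ⟨b, hb⟩, -⟩
        rcases hd' i hi j hj hij a b hb.symm with ⟨ha0, -⟩ | ⟨ha1, -⟩
        · rw [mem_setOf_eq, ha0, hs i hi 0 unitInterval.nonneg', h0 i hi] at ha
          linarith
        · rw [ha1, h1' i hi]; rfl)
    refine no_log_frontier hb hxC (fun _ => 1) continuous_const (by simp) ?_
    refine (this.mono ?_).congr (fun z _ => by simp)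
    intro z hz
    right
    have hz' := hfr hz
    simp only [hXdef', mem_iUnion] at hz' ⊢
    obtain ⟨i, hi, hz'⟩ := hz'
    exact ⟨i, hi, hz', hcl (frontier_subset_closure hz)⟩
  -- decomposition
  set Y := ⋃ i ∈ J, γ i '' Iic (s i) with hY
  set T := ⋃ i ∈ J, γ i '' Ici (s i) with hT
  set T' := ⋃ i ∈ J, γ' i '' Ici (s i) with hT'
  have hYc : IsClosed Y := hJ.isClosed_biUnion fun i hi =>
    (isClosed_Iic.isCompact.image (hγ i hi)).isClosed
  have hTc' : IsClosed T' := hJ.isClosed_biUnion fun i hi =>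
    (isClosed_Ici.isCompact.image (hγ' i hi)).isClosed
  have hXYT : X = Y ∪ T := by
    ext z
    simp only [hXdef, hY, hT, mem_union, mem_iUnion]
    constructor
    · rintro ⟨i, hi, t, rfl⟩
      rcases le_total t (s i) with h | h
      · exact Or.inl ⟨i, hi, t, h, rfl⟩
      · exact Or.inr ⟨i, hi, t, h, rfl⟩
    · rintro (⟨i, hi, t, -, rfl⟩ | ⟨i, hi, t, -, rfl⟩) <;> exact ⟨i, hi, t, rfl⟩
  have hYeq : Y = ⋃ i ∈ J, γ' i '' Iic (s i) := by
    rw [hY]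
    refine iUnion₂_congr fun i hi => image_congr fun t ht => (hs i hi t ht).symm
  have hXYT' : X' = Y ∪ T' := by
    rw [hYeq]
    ext z
    simp only [hXdef', hT', mem_union, mem_iUnion]
    constructor
    · rintro ⟨i, hi, t, rfl⟩
      rcases le_total t (s i) with h | h
      · exact Or.inl ⟨i, hi, t, h, rfl⟩
      · exact Or.inr ⟨i, hi, t, h, rfl⟩
    · rintro (⟨i, hi, t, -, rfl⟩ | ⟨i, hi, t, -, rfl⟩) <;> exact ⟨i, hi, t, rfl⟩
  have hTD : T ⊆ D := by
    intro z hz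
    simp only [hT, mem_iUnion] at hz
    obtain ⟨i, hi, t, ht, rfl⟩ := hz
    exact hD i hi t ht
  have hTD' : T' ⊆ D := by
    intro z hz
    simp only [hT', mem_iUnion] at hz
    obtain ⟨i, hi, t, ht, rfl⟩ := hz
    exact hD' i hi t ht
  have hpre : ∀ (δ : ι → unitInterval → ℝ × ℝ) (p : ℝ × ℝ), (∀ i ∈ J, Continuous (δ i)) →
      (∀ i ∈ J, δ i 1 = p) → IsPreconnected (⋃ i ∈ J, δ i '' Ici (s i)) := by
    intro δ p hδ hp
    rw [← sUnion_image]
    apply isPreconnected_sUnion p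
    · rintro _ ⟨i, hi, rfl⟩
      exact ⟨1, unitInterval.le_one', hp i hi⟩
    · rintro _ ⟨i, hi, rfl⟩
      exact (ordConnected_Ici.isPreconnected).image _ (hδ i hi).continuousOn
  have hTp : IsPreconnected T := hpre γ v hγ h1
  have hYT' : Y ∩ T' ⊆ T := by
    rintro z ⟨hzY, hzT⟩
    rw [hYeq] at hzY
    simp only [hT', mem_iUnion] at hzT hzY
    obtain ⟨i, hi, a, ha, rfl⟩ := hzY
    obtain ⟨j, hj, b, hb, hab⟩ := hzT
    by_cases hij : i = j
    · subst hij
      have := hi' i hi hab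
      subst this
      have : b = s i := le_antisymm ha hb
      exact mem_biUnion hi ⟨b, hb, (hs i hi b ha).symm⟩
    · rcases hd' i hi j hj hij a b hab.symm with ⟨-, h⟩ | ⟨h, -⟩
      · exact absurd (le_antisymm (h ▸ hb) unitInterval.nonneg') (hs0 j hj)
      · subst h
        exact mem_biUnion hi ⟨1, unitInterval.le_one', (hs i hi 1 ha).symm⟩
  have hlogD : ∀ y, y ∉ D → HasLog D (fun z => cx z - cx y) := fun y hy =>
    hasLog_disc (v := v) fun z hz => lt_of_lt_of_le hz (not_lt.1 hy)
  have hx0X' : x0 ∉ X' := hC'X hx0C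
  have hx0X : x0 ∉ X := by
    rw [hXYT]
    rintro (h | h)
    · exact hx0X' (hXYT' ▸ Or.inl h)
    · exact hx0D (hTD h)
  refine ⟨x0, hx0X, ?_, ?_⟩
  · by_contra hnb
    have h1 := hasLog_of_unbounded hX isPreconnected_connectedComponentIn
      (connectedComponentIn_subset _ _) hnb (mem_connectedComponentIn hx0X)
    rw [hXYT] at h1
    have h2 := hasLog_glue hYc hTc' hTp hTD hTD' hYT' (hlogD x0 hx0D) h1
    rw [← hXYT'] at h2
    exact no_log_frontier hb hx0C (fun _ => 1) continuous_const (by simp)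
      ((h2.mono hfr).congr (fun z _ => by simp))
  · intro y hyR hyX' hy
    by_contra hyC
    have h1 := hasLog_of_component hX isPreconnected_connectedComponentIn
      (connectedComponentIn_subset _ _) (mem_connectedComponentIn hx0X) hy
    rw [hXYT] at h1
    have h2 := hasLog_glue hYc hTc' hTp hTD hTD' hYT'
      ((hlogD x0 hx0D).mul (hlogD y (not_lt.2 hyR)).inv) h1
    rw [← hXYT'] at h2
    refine no_log_frontier hb hx0C (fun z => cx z - cx y) (continuous_cx.sub continuous_const)
      ?_ (h2.mono hfr)
    intro z hz
    apply cx_sub_ne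
    rintro rfl
    rw [closure_eq_self_union_frontier] at hz
    exact hz.elim hyC fun h => hyX' (hfr h)

end SplitAux


namespace SplitAux

theorem cx_add (a b : ℝ × ℝ) : cx (a + b) = cx a + cx b := rfl

theorem cx_smul (c : ℝ) (a : ℝ × ℝ) : cx (c • a) = c * cx a := by
  apply Complex.ext <;> simp [cx]

theorem cx_sub (a b : ℝ × ℝ) : cx (a - b) = cx a - cx b := rfl

theorem norm_combo_lt {v p w : ℝ × ℝ} {r τ : ℝ} (hp : ‖cx p - cx v‖ = r) (hw : ‖cx w - cx v‖ < r)
    (h0 : 0 < τ) (h1 : τ ≤ 1) : ‖cx (p + τ • (w - p)) - cx v‖ < r := by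
  have : cx (p + τ • (w - p)) - cx v
      = ((1 - τ : ℝ) : ℂ) * (cx p - cx v) + (τ : ℂ) * (cx w - cx v) := by
    rw [cx_add, cx_smul, cx_sub]; push_cast; ring
  rw [this]
  refine (norm_add_le _ _).trans_lt ?_
  rw [norm_mul, norm_mul, Complex.norm_real, Complex.norm_real, hp, Real.norm_of_nonneg h0.le,
    Real.norm_of_nonneg (by linarith)]
  nlinarith

/-- Two segments from distinct points of a circle to a common interior point. -/
theorem segments_meet {v p q w : ℝ × ℝ} {r τ σ : ℝ} (hp : ‖cx p - cx v‖ = r)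
    (hq : ‖cx q - cx v‖ = r) (hw : ‖cx w - cx v‖ < r) (hpq : p ≠ q) (hτ : 0 ≤ τ) (hτ1 : τ ≤ 1)
    (hσ : 0 ≤ σ) (hσ1 : σ ≤ 1) (h : p + τ • (w - p) = q + σ • (w - q)) : τ = 1 ∧ σ = 1 := by
  have key : ∀ (p q : ℝ × ℝ) (τ σ : ℝ), ‖cx p - cx v‖ = r → ‖cx q - cx v‖ = r → 0 ≤ τ → σ ≤ 1 →
      p + τ • (w - p) = q + σ • (w - q) → ¬ τ < σ := by
    intro p q τ σ hp hq hτ hσ1 h hlt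
    have h1 : p = q + ((σ - τ) / (1 - τ)) • (w - q) := by
      have h1τ : (1 - τ) ≠ 0 := by
        intro h; linarith
      have e1 := congrArg Prod.fst h
      have e2 := congrArg Prod.snd h
      simp only [Prod.fst_add, Prod.smul_fst, Prod.fst_sub, smul_eq_mul, Prod.snd_add,
        Prod.smul_snd, Prod.snd_sub] at e1 e2
      apply Prod.ext
      · simp only [Prod.fst_add, Prod.smul_fst, Prod.fst_sub, smul_eq_mul]
        field_simp
        linear_combination e1
      · simp only [Prod.snd_add, Prod.smul_snd, Prod.snd_sub, smul_eq_mul]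
        field_simp
        linear_combination e2
    have := norm_combo_lt (τ := (σ - τ) / (1 - τ)) hq hw
      (div_pos (by linarith) (by linarith)) ((div_le_one (by linarith)).2 (by linarith))
    rw [← h1, hp] at this
    exact lt_irrefl _ this
  have e : τ = σ := le_antisymm (not_lt.1 (key q p σ τ hq hp hσ hτ1 h.symm))
    (not_lt.1 (key p q τ σ hp hq hτ hσ1 h))
  subst e
  by_contra hne
  have hne1 : 1 - τ ≠ 0 := fun h => hne ⟨by linarith, by linarith⟩
  apply hpq
  have e1 := congrArg Prod.fst h
  have e2 := congrArg Prod.snd h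
  simp only [Prod.fst_add, Prod.smul_fst, Prod.fst_sub, smul_eq_mul, Prod.snd_add,
    Prod.smul_snd, Prod.snd_sub] at e1 e2
  apply Prod.ext
  · apply mul_left_cancel₀ hne1; linear_combination e1
  · apply mul_left_cancel₀ hne1; linear_combination e2

/-- Follow `γ` up to time `s`, then go straight to `w`. -/
noncomputable def reroute (γ : unitInterval → ℝ × ℝ) (s : unitInterval) (w : ℝ × ℝ) :
    unitInterval → ℝ × ℝ :=
  fun t => if t ≤ s then γ t else γ s + (((t : ℝ) - s) / (1 - s)) • (w - γ s)

theorem reroute_of_le {γ : unitInterval → ℝ × ℝ} {s t : unitInterval} {w : ℝ × ℝ} (h : t ≤ s) :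
    reroute γ s w t = γ t := by simp [reroute, h]

theorem reroute_of_ge {γ : unitInterval → ℝ × ℝ} {s t : unitInterval} {w : ℝ × ℝ} (h : s ≤ t) :
    reroute γ s w t = γ s + (((t : ℝ) - s) / (1 - s)) • (w - γ s) := by
  rcases h.eq_or_lt with rfl | h
  · simp [reroute]
  · simp [reroute, not_le.2 h]

theorem reroute_one {γ : unitInterval → ℝ × ℝ} {s : unitInterval} {w : ℝ × ℝ} (h : s < 1) :
    reroute γ s w 1 = w := by
  have h' : (s : ℝ) < 1 := h
  rw [reroute_of_ge h.le]
  simp [div_self (show (1 : ℝ) - s ≠ 0 by linarith)]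

theorem reroute_zero {γ : unitInterval → ℝ × ℝ} {s : unitInterval} {w : ℝ × ℝ} :
    reroute γ s w 0 = γ 0 := reroute_of_le unitInterval.nonneg'

theorem reroute_continuous {γ : unitInterval → ℝ × ℝ} (hγ : Continuous γ) (s : unitInterval)
    (w : ℝ × ℝ) : Continuous (reroute γ s w) := by
  unfold reroute
  apply Continuous.if_le hγ _ continuous_id continuous_const
  · intro t ht
    simp only [id] at ht
    simp [ht]
  · fun_prop

theorem param_bounds {s t : unitInterval} (h1 : s < 1) (h : s ≤ t) :
    0 ≤ ((t : ℝ) - s) / (1 - s) ∧ ((t : ℝ) - s) / (1 - s) ≤ 1 ∧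
    (s < t → 0 < ((t : ℝ) - s) / (1 - s)) ∧ (((t : ℝ) - s) / (1 - s) = 1 → t = 1) := by
  have h1' : (s : ℝ) < 1 := h1
  have h' : (s : ℝ) ≤ t := h
  have ht : (t : ℝ) ≤ 1 := t.2.2
  have hp : (0 : ℝ) < 1 - s := by linarith
  refine ⟨div_nonneg (by linarith) hp.le, (div_le_one hp).2 (by linarith), fun hlt => ?_,
    fun heq => ?_⟩
  · have : (s : ℝ) < t := hlt
    exact div_pos (by linarith) hp
  · rw [div_eq_one_iff_eq hp.ne'] at heq
    apply Subtype.ext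
    change (t : ℝ) = 1
    linarith

theorem reroute_norm_lt {γ : unitInterval → ℝ × ℝ} {s t : unitInterval} {v w : ℝ × ℝ} {r : ℝ}
    (hs : s < 1) (hp : ‖cx (γ s) - cx v‖ = r) (hw : ‖cx w - cx v‖ < r) (h : s < t) :
    ‖cx (reroute γ s w t) - cx v‖ < r := by
  rw [reroute_of_ge h.le]
  obtain ⟨-, h2, h3, -⟩ := param_bounds hs h.le
  exact norm_combo_lt hp hw (h3 h) h2

theorem reroute_norm_ge {γ : unitInterval → ℝ × ℝ} {s t : unitInterval} {v w : ℝ × ℝ} {r : ℝ}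
    (hp : ‖cx (γ s) - cx v‖ = r) (hlt : ∀ t < s, r < ‖cx (γ t) - cx v‖) (h : t ≤ s) :
    r ≤ ‖cx (reroute γ s w t) - cx v‖ := by
  rw [reroute_of_le h]
  rcases h.eq_or_lt with rfl | h
  · exact hp.ge
  · exact (hlt t h).le

theorem reroute_injective {γ : unitInterval → ℝ × ℝ} {s : unitInterval} {v w : ℝ × ℝ} {r : ℝ}
    (hi : Function.Injective γ)
    (hs : s < 1) (hp : ‖cx (γ s) - cx v‖ = r) (hw : ‖cx w - cx v‖ < r)
    (hlt : ∀ t < s, r < ‖cx (γ t) - cx v‖) : Function.Injective (reroute γ s w) := by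
  have hne : w - γ s ≠ 0 := by
    intro h
    rw [sub_eq_zero] at h
    rw [h] at hw; linarith
  intro a b hab
  rcases le_or_gt a s with ha | ha <;> rcases le_or_gt b s with hb | hb
  · rw [reroute_of_le ha, reroute_of_le hb] at hab
    exact hi hab
  · have h1 := reroute_norm_ge (w := w) hp hlt ha
    have h2 := reroute_norm_lt hs hp hw hb
    rw [hab] at h1; linarith
  · have h1 := reroute_norm_ge (w := w) hp hlt hb
    have h2 := reroute_norm_lt hs hp hw ha
    rw [hab] at h2; linarith
  · rw [reroute_of_ge ha.le, reroute_of_ge hb.le] at hab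
    have h := smul_left_injective ℝ hne (add_left_cancel hab)
    have h1' : (s : ℝ) < 1 := hs
    have : (1 : ℝ) - s ≠ 0 := by linarith
    rw [div_left_inj' this] at h
    apply Subtype.ext
    linarith

/-- choice of the small discs. -/
theorem exists_discs (G : TopMultigraph) (v : ℝ × ℝ) (hv : v ∈ G.V) (hsc : G.SingleCrossing)
    (hnorm : ∀ e, G.arc e 0 ≠ v) :
    ∃ R r : ℝ, 0 < r ∧ r < R ∧ ∃ s : G.ι → unitInterval,
      (∀ y ∈ G.V, y ≠ v → R < ‖cx y - cx v‖) ∧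
      (∀ e, G.arc e 1 ≠ v → ∀ t, R < ‖cx (G.arc e t) - cx v‖) ∧
      (∀ e f, e ≠ f → ∀ z ∈ G.arcInterior e ∩ G.arcInterior f, R < ‖cx z - cx v‖) ∧
      (∀ e, G.arc e 1 = v → s e < 1 ∧ (∀ t < s e, r < ‖cx (G.arc e t) - cx v‖) ∧
        ‖cx (G.arc e (s e)) - cx v‖ = r ∧ ∀ t, s e ≤ t → ‖cx (G.arc e t) - cx v‖ < R) := by
  -- a closed set missing `v` stays away from `v`
  have away : ∀ K : Set (ℝ × ℝ), IsCompact K → v ∉ K → ∃ ρ > 0, ∀ z ∈ K, ρ < ‖cx z - cx v‖ := by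
    intro K hK hvK
    have hc : IsClosed (cx '' K) := (hK.image continuous_cx).isClosed
    have hna : cx v ∈ (cx '' K)ᶜ := by
      rintro ⟨z, hz, hza⟩
      exact hvK (cx_injective hza ▸ hz)
    obtain ⟨δ, hδ, hb⟩ := Metric.isOpen_iff.1 hc.isOpen_compl _ hna
    refine ⟨δ / 2, by linarith, fun z hz => ?_⟩
    by_contra hlt
    push Not at hlt
    exact hb (mem_ball_iff_norm.2 (by linarith)) ⟨z, hz, rfl⟩
  have hfin : ∀ S : Set G.ι, S.Finite := fun S => S.toFinite
  let K1 : Set (ℝ × ℝ) := (G.V : Set (ℝ × ℝ)) \ {v}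
  let K2 : Set (ℝ × ℝ) := ⋃ e ∈ {e | G.arc e 1 ≠ v}, range (G.arc e)
  let K3 : Set (ℝ × ℝ) := ⋃ p ∈ {p : G.ι × G.ι | p.1 ≠ p.2}, G.arcInterior p.1 ∩ G.arcInterior p.2
  have hK1 : IsCompact K1 := (G.V.finite_toSet.subset sdiff_subset).isCompact
  have hK2 : IsCompact K2 := (hfin _).isCompact_biUnion fun e _ =>
    isCompact_range (G.continuous_arc e)
  have hK3 : IsCompact K3 := (Set.toFinite _).isCompact_biUnion fun p hp =>
    (hsc p.1 p.2 hp).isCompact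
  have hvint : ∀ e, v ∉ G.arcInterior e := by
    rintro e ⟨t, ⟨ht0, ht1⟩, hvt⟩
    exact G.interior_avoids e t ht0 ht1 (hvt ▸ hv)
  have hvr : ∀ e, v ∈ range (G.arc e) → G.arc e 1 = v := by
    rintro e ⟨t, ht⟩
    by_cases ht0 : t = 0
    · exact absurd (ht0 ▸ ht) (hnorm e)
    by_cases ht1 : t = 1
    · exact ht1 ▸ ht
    exact absurd ⟨t, ⟨ht0, ht1⟩, ht⟩ (hvint e)
  obtain ⟨R, hR, hRK⟩ := away (K1 ∪ K2 ∪ K3) ((hK1.union hK2).union hK3) (by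
    rintro ((h | h) | h)
    · exact h.2 rfl
    · simp only [K2, mem_iUnion] at h
      obtain ⟨e, he, h⟩ := h
      exact he (hvr e h)
    · simp only [K3, mem_iUnion] at h
      obtain ⟨e, he, h⟩ := h
      exact hvint _ h.1)
  have hcont : ∀ e, Continuous fun t => ‖cx (G.arc e t) - cx v‖ := fun e =>
    ((continuous_cx.comp (G.continuous_arc e)).sub continuous_const).norm
  -- times after which the arcs stay in the big disc
  have hσ : ∀ e, ∃ σ : unitInterval, G.arc e 1 = v →
      σ < 1 ∧ ∀ t, σ < t → ‖cx (G.arc e t) - cx v‖ < R := by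
    intro e
    by_cases he : G.arc e 1 = v
    · have hev : ∀ᶠ t in nhds (1 : unitInterval), ‖cx (G.arc e t) - cx v‖ < R :=
        ((hcont e).tendsto 1).eventually (gt_mem_nhds (by simpa [he] using hR))
      obtain ⟨σ, hσ, h⟩ := exists_Ioc_subset_of_mem_nhds hev ⟨0, zero_lt_one⟩
      exact ⟨σ, fun _ => ⟨hσ, fun t ht => h ⟨ht, unitInterval.le_one'⟩⟩⟩
    · exact ⟨0, fun h => absurd h he⟩
  choose σ hσ using hσ
  let K4 : Set (ℝ × ℝ) := ⋃ e ∈ {e | G.arc e 1 = v}, G.arc e '' Iic (σ e)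
  have hK4 : IsCompact K4 := (hfin _).isCompact_biUnion fun e _ =>
    isClosed_Iic.isCompact.image (G.continuous_arc e)
  obtain ⟨r', hr', hrK⟩ := away K4 hK4 (by
    intro h
    simp only [K4, mem_iUnion] at h
    obtain ⟨e, he, t, ht, h⟩ := h
    have h1 : t = 1 := G.injective_arc e (h.trans (show G.arc e 1 = v from he).symm)
    have := (hσ e he).1
    rw [h1] at ht
    exact absurd (show (1 : unitInterval) ≤ σ e from ht) (not_le.2 this))
  let r := min r' (R / 2)
  have hr : 0 < r := lt_min hr' (by linarith)
  have hs : ∀ e, ∃ s : unitInterval, G.arc e 1 = v →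
      s < 1 ∧ (∀ t < s, r < ‖cx (G.arc e t) - cx v‖) ∧
        ‖cx (G.arc e s) - cx v‖ = r ∧ ∀ t, s ≤ t → ‖cx (G.arc e t) - cx v‖ < R := by
    intro e
    by_cases he : G.arc e 1 = v
    · have hcl : IsClosed {t | ‖cx (G.arc e t) - cx v‖ ≤ r} :=
        isClosed_le (hcont e) continuous_const
      obtain ⟨s, hs, hmin⟩ := hcl.isCompact.exists_isLeast ⟨1, by
        change ‖cx (G.arc e 1) - cx v‖ ≤ r
        rw [he]; simpa using hr.le⟩
      have hs' : ‖cx (G.arc e s) - cx v‖ ≤ r := hs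
      have hlt : ∀ t < s, r < ‖cx (G.arc e t) - cx v‖ := by
        intro t ht
        by_contra hcon
        exact absurd (hmin (not_lt.1 hcon)) (not_le.2 ht)
      have hσs : σ e < s := by
        by_contra hcon
        have := hrK (G.arc e s) (mem_biUnion he ⟨s, not_lt.1 hcon, rfl⟩)
        have h2 : r ≤ r' := min_le_left _ _
        linarith
      have heq : ‖cx (G.arc e s) - cx v‖ = r := by
        by_contra hne
        have hlt' := lt_of_le_of_ne hs' hne
        have hev : ∀ᶠ t in nhds s, ‖cx (G.arc e t) - cx v‖ < r :=
          ((hcont e).tendsto s).eventually (gt_mem_nhds hlt')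
        obtain ⟨l, hl, h⟩ := exists_Ioc_subset_of_mem_nhds hev ⟨σ e, hσs⟩
        obtain ⟨m, hm1, hm2⟩ := exists_between hl
        have h1 : ‖cx (G.arc e m) - cx v‖ < r := h ⟨hm1, hm2.le⟩
        exact lt_asymm h1 (hlt m hm2)
      refine ⟨s, fun _ => ⟨?_, hlt, heq, fun t ht => (hσ e he).2 t (hσs.trans_le ht)⟩⟩
      refine lt_of_le_of_ne unitInterval.le_one' ?_
      intro h1
      rw [h1, he] at heq
      simp at heq
      linarith
    · exact ⟨0, fun h => absurd h he⟩
  choose s hs using hs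
  refine ⟨R, r, hr, (min_le_right _ _).trans_lt (by linarith), s, ?_, ?_, ?_, hs⟩
  · exact fun y hy hyv => hRK y (Or.inl (Or.inl ⟨hy, hyv⟩))
  · exact fun e he t => hRK _ (Or.inl (Or.inr (mem_biUnion he ⟨t, rfl⟩)))
  · exact fun e f hef z hz => hRK z (Or.inr (mem_biUnion (x := (e, f)) hef hz))

end SplitAux


namespace SplitAux

/-- All data needed for splitting the vertex `v`. -/
structure SplitData (G : TopMultigraph) (v : ℝ × ℝ) where
  R : ℝ
  r : ℝ
  s : G.ι → unitInterval
  W : G.ι → ℝ × ℝ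
  V' : Finset (ℝ × ℝ)
  hr : 0 < r
  hrR : r < R
  hnorm : ∀ e, G.arc e 0 ≠ v
  hV : ∀ y ∈ G.V, y ≠ v → R < ‖cx y - cx v‖
  harc : ∀ e, G.arc e 1 ≠ v → ∀ t, R < ‖cx (G.arc e t) - cx v‖
  hcross : ∀ e f, e ≠ f → ∀ z ∈ G.arcInterior e ∩ G.arcInterior f, R < ‖cx z - cx v‖
  hs1 : ∀ e, G.arc e 1 = v → s e < 1
  hs2 : ∀ e, G.arc e 1 = v → ∀ t < s e, r < ‖cx (G.arc e t) - cx v‖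
  hs3 : ∀ e, G.arc e 1 = v → ‖cx (G.arc e (s e)) - cx v‖ = r
  hs4 : ∀ e, G.arc e 1 = v → ∀ t, s e ≤ t → ‖cx (G.arc e t) - cx v‖ < R
  hW : ∀ e, G.arc e 1 = v → ‖cx (W e) - cx v‖ < r
  hWV : ∀ e, G.arc e 1 = v → W e ∈ V'
  hVV : ∀ y ∈ G.V, y ≠ v → y ∈ V'
  hVV2 : ∀ y ∈ V', (y ∈ G.V ∧ y ≠ v) ∨ ‖cx y - cx v‖ < r
  hex : ∃ w ∈ V', ‖cx w - cx v‖ < r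
  hav : ∀ e, G.arc e 1 = v → ∀ t, s e ≤ t → t ≠ 1 → reroute (G.arc e) (s e) (W e) t ∉ V'
  hdis : ∀ e f, G.arc e 1 = v → G.arc f 1 = v → e ≠ f → ∀ a b, s e ≤ a → s f ≤ b →
    reroute (G.arc e) (s e) (W e) a = reroute (G.arc f) (s f) (W f) b → a = 1 ∧ b = 1

namespace SplitData

variable {G : TopMultigraph} {v : ℝ × ℝ} (D : SplitData G v)

open Classical in
/-- The new arcs. -/
noncomputable def narc (e : G.ι) : unitInterval → ℝ × ℝ :=
  if G.arc e 1 = v then reroute (G.arc e) (D.s e) (D.W e) else G.arc e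

theorem narc_inc {e : G.ι} (h : G.arc e 1 = v) :
    D.narc e = reroute (G.arc e) (D.s e) (D.W e) := by simp [narc, h]

theorem narc_not {e : G.ι} (h : G.arc e 1 ≠ v) : D.narc e = G.arc e := by simp [narc, h]

theorem narc_zero (e : G.ι) : D.narc e 0 = G.arc e 0 := by
  by_cases h : G.arc e 1 = v
  · rw [D.narc_inc h, reroute_zero]
  · rw [D.narc_not h]

theorem narc_one {e : G.ι} (h : G.arc e 1 = v) : D.narc e 1 = D.W e := by
  rw [D.narc_inc h, reroute_one (D.hs1 e h)]

theorem narc_le {e : G.ι} {t : unitInterval} (ht : t ≤ D.s e) : D.narc e t = G.arc e t := by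
  by_cases h : G.arc e 1 = v
  · rw [D.narc_inc h, reroute_of_le ht]
  · rw [D.narc_not h]

theorem narc_ge {e : G.ι} (h : G.arc e 1 = v) {t : unitInterval} (ht : D.s e ≤ t) :
    ‖cx (D.narc e t) - cx v‖ ≤ D.r := by
  rcases ht.eq_or_lt with rfl | ht
  · rw [D.narc_le le_rfl, D.hs3 e h]
  · rw [D.narc_inc h]
    exact (reroute_norm_lt (D.hs1 e h) (D.hs3 e h) (D.hW e h) ht).le

theorem far_zero (e : G.ι) : D.R < ‖cx (G.arc e 0) - cx v‖ :=
  D.hV _ (G.source_mem e) (D.hnorm e)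

/-- The split graph. -/
noncomputable def graph : TopMultigraph where
  V := D.V'
  ι := G.ι
  fintype_ι := G.fintype_ι
  arc := D.narc
  continuous_arc := by
    intro e
    by_cases h : G.arc e 1 = v
    · rw [D.narc_inc h]; exact reroute_continuous (G.continuous_arc e) _ _
    · rw [D.narc_not h]; exact G.continuous_arc e
  injective_arc := by
    intro e
    by_cases h : G.arc e 1 = v
    · rw [D.narc_inc h]
      exact reroute_injective (G.injective_arc e) (D.hs1 e h) (D.hs3 e h) (D.hW e h) (D.hs2 e h)
    · rw [D.narc_not h]; exact G.injective_arc e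
  source_mem := by
    intro e
    rw [D.narc_zero]
    exact D.hVV _ (G.source_mem e) (D.hnorm e)
  target_mem := by
    intro e
    by_cases h : G.arc e 1 = v
    · rw [D.narc_one h]; exact D.hWV e h
    · rw [D.narc_not h]; exact D.hVV _ (G.target_mem e) h
  ends_ne := by
    intro e
    by_cases h : G.arc e 1 = v
    · rw [D.narc_one h, D.narc_zero]
      intro heq
      have h1 := D.far_zero e
      have h2 := D.hW e h
      have h3 := D.hrR
      rw [heq] at h1
      linarith
    · rw [D.narc_not h]; exact G.ends_ne e
  interior_avoids := by
    intro e t h0 h1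
    by_cases h : G.arc e 1 = v
    · rcases lt_or_ge t (D.s e) with ht | ht
      · rw [D.narc_le ht.le]
        intro hmem
        rcases D.hVV2 _ hmem with h2 | h2
        · exact G.interior_avoids e t h0 h1 h2.1
        · exact lt_asymm h2 (D.hs2 e h t ht)
      · rw [D.narc_inc h]; exact D.hav e h t ht h1
    · rw [D.narc_not h]
      intro hmem
      rcases D.hVV2 _ hmem with h2 | h2
      · exact G.interior_avoids e t h0 h1 h2.1
      · have := D.harc e h t
        have := D.hrR
        linarith

theorem int_sub {e : G.ι} {z : ℝ × ℝ} (hz : z ∈ D.graph.arcInterior e)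
    (hN : D.r < ‖cx z - cx v‖) : z ∈ G.arcInterior e := by
  obtain ⟨t, ht, rfl⟩ := hz
  change D.r < ‖cx (D.narc e t) - cx v‖ at hN
  change D.narc e t ∈ _
  by_cases h : G.arc e 1 = v
  · have : t < D.s e := by
      by_contra hcon
      exact absurd (D.narc_ge h (not_lt.1 hcon)) (not_le.2 hN)
    rw [D.narc_le this.le]
    exact ⟨t, ht, rfl⟩
  · rw [D.narc_not h]; exact ⟨t, ht, rfl⟩

theorem sub_int {e : G.ι} {z : ℝ × ℝ} (hz : z ∈ G.arcInterior e)
    (hN : D.R < ‖cx z - cx v‖) : z ∈ D.graph.arcInterior e := by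
  obtain ⟨t, ht, rfl⟩ := hz
  refine ⟨t, ht, ?_⟩
  change D.narc e t = _
  by_cases h : G.arc e 1 = v
  · have : t < D.s e := by
      by_contra hcon
      exact lt_asymm (D.hs4 e h t (not_lt.1 hcon)) hN
    rw [D.narc_le this.le]
  · rw [D.narc_not h]

theorem near_int {e : G.ι} {z : ℝ × ℝ} (hz : z ∈ D.graph.arcInterior e)
    (hN : ‖cx z - cx v‖ ≤ D.r) : G.arc e 1 = v ∧ ∃ a, D.s e ≤ a ∧ a ≠ 1 ∧
      reroute (G.arc e) (D.s e) (D.W e) a = z := by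
  obtain ⟨t, ht, rfl⟩ := hz
  change ‖cx (D.narc e t) - cx v‖ ≤ D.r at hN
  have h : G.arc e 1 = v := by
    by_contra h
    rw [D.narc_not h] at hN
    have := D.harc e h t
    have := D.hrR
    linarith
  refine ⟨h, t, ?_, ht.2, ?_⟩
  · by_contra hcon
    have h1 := D.hs2 e h t (not_le.1 hcon)
    rw [D.narc_le (not_le.1 hcon).le] at hN
    linarith
  · change _ = D.narc e t
    rw [D.narc_inc h]

theorem int_inter {e f : G.ι} (hef : e ≠ f) :
    D.graph.arcInterior e ∩ D.graph.arcInterior f = G.arcInterior e ∩ G.arcInterior f := by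
  ext z
  constructor
  · rintro ⟨h1, h2⟩
    rcases lt_or_ge D.r ‖cx z - cx v‖ with hN | hN
    · exact ⟨D.int_sub h1 hN, D.int_sub h2 hN⟩
    · obtain ⟨he, a, ha, ha1, hza⟩ := D.near_int h1 hN
      obtain ⟨hf, b, hb, hb1, hzb⟩ := D.near_int h2 hN
      exact absurd (D.hdis e f he hf hef a b ha hb (hza.trans hzb.symm)).1 ha1
  · intro hz
    have := D.hcross e f hef z hz
    exact ⟨D.sub_int hz.1 this, D.sub_int hz.2 this⟩

theorem cross_iff {e f : G.ι} (hef : e ≠ f) : D.graph.Cross e f ↔ G.Cross e f := by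
  unfold TopMultigraph.Cross
  rw [D.int_inter hef]

theorem singleCrossing (h : G.SingleCrossing) : D.graph.SingleCrossing := by
  intro e f hef
  rw [D.int_inter hef]
  exact h e f hef

theorem crossingNumber_eq : D.graph.crossingNumber = G.crossingNumber := by
  unfold TopMultigraph.crossingNumber
  apply Nat.card_congr
  apply Equiv.subtypeEquivRight
  intro p
  refine and_congr Iff.rfl ?_
  exact forall_congr' fun e => forall_congr' fun _ => forall_congr' fun f => forall_congr' fun _ =>
    forall_congr' fun hef => D.cross_iff hef

theorem endpoints_inc {e : G.ι} (h : G.arc e 1 = v) :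
    D.graph.endpoints e = {G.arc e 0, D.W e} := by
  change {D.narc e 0, D.narc e 1} = _
  rw [D.narc_zero, D.narc_one h]

theorem endpoints_not {e : G.ι} (h : G.arc e 1 ≠ v) : D.graph.endpoints e = G.endpoints e := by
  change {D.narc e 0, D.narc e 1} = _
  rw [D.narc_not h]; rfl

theorem endpoints_old {e : G.ι} (h : G.arc e 1 = v) : G.endpoints e = {G.arc e 0, v} := by
  change {G.arc e 0, G.arc e 1} = _
  rw [h]

/-- if two edges have the same new endpoints and the first is incident, so is the second. -/
theorem same_ends {e f : G.ι} (he : G.arc e 1 = v)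
    (h : D.graph.endpoints e = D.graph.endpoints f) :
    G.arc f 1 = v ∧ G.arc f 0 = G.arc e 0 ∧ D.W f = D.W e := by
  have hrR := D.hrR
  have hWe := D.hW e he
  have hm : D.W e ∈ D.graph.endpoints f := by rw [← h, D.endpoints_inc he]; simp
  have hf : G.arc f 1 = v := by
    by_contra hf
    rw [D.endpoints_not hf] at hm
    rcases hm with hm | hm
    · have := D.harc f hf 0
      rw [← hm] at this; linarith
    · have := D.harc f hf 1
      rw [← (show D.W e = _ from hm)] at this; linarith
  rw [D.endpoints_inc hf] at hm
  refine ⟨hf, ?_, ?_⟩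
  · have h0 : G.arc f 0 ∈ D.graph.endpoints e := by rw [h, D.endpoints_inc hf]; simp
    rw [D.endpoints_inc he] at h0
    rcases h0 with h0 | h0
    · exact h0
    · have := D.far_zero f
      rw [show G.arc f 0 = _ from h0] at this; linarith
  · rcases hm with hm | hm
    · have := D.far_zero f
      rw [← (show D.W e = _ from hm)] at this; linarith
    · exact (show D.W e = _ from hm).symm

theorem parallel {e f : G.ι} (h : D.graph.Parallel e f) : G.Parallel e f := by
  obtain ⟨hne, h⟩ := h
  refine ⟨hne, ?_⟩
  by_cases he : G.arc e 1 = v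
  · obtain ⟨hf, h0, -⟩ := D.same_ends he h
    rw [endpoints_old he, endpoints_old hf, h0]
  · by_cases hf : G.arc f 1 = v
    · exact absurd (D.same_ends hf h.symm).1 he
    · rwa [D.endpoints_not he, D.endpoints_not hf] at h

theorem convex_disc (v : ℝ × ℝ) (R : ℝ) : Convex ℝ {z : ℝ × ℝ | ‖cx z - cx v‖ < R} := by
  have h : IsLinearMap ℝ cx := ⟨cx_add, fun c x => by rw [cx_smul]; simp⟩
  have := (convex_ball (cx v) R).is_linear_preimage h
  have e : {z : ℝ × ℝ | ‖cx z - cx v‖ < R} = cx ⁻¹' Metric.ball (cx v) R := by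
    ext z
    simp [dist_eq_norm]
  rw [e]
  exact this

theorem closed_union (γ : G.ι → unitInterval → ℝ × ℝ) (h : ∀ e, Continuous (γ e)) (J : Set G.ι) :
    IsClosed (⋃ e ∈ J, range (γ e)) :=
  (J.toFinite).isClosed_biUnion fun e _ => (isCompact_range (h e)).isClosed

theorem lens_caseB (hsep : G.Separated) {e₀ : G.ι} (he₀ : G.arc e₀ 1 = v)
    (hnc : ∀ e f : G.ι, D.graph.Joins e (G.arc e₀ 0) (D.W e₀) →
      D.graph.Joins f (G.arc e₀ 0) (D.W e₀) → e ≠ f → ¬ D.graph.Cross e f)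
    {x : ℝ × ℝ} (hx : x ∉ D.graph.pairUnion (G.arc e₀ 0) (D.W e₀))
    (hb : Bornology.IsBounded
      (connectedComponentIn (D.graph.pairUnion (G.arc e₀ 0) (D.W e₀))ᶜ x)) :
    ∃ y ∈ D.V', y ∈ connectedComponentIn (D.graph.pairUnion (G.arc e₀ 0) (D.W e₀))ᶜ x := by
  set u := G.arc e₀ 0 with hu
  set w := D.W e₀ with hw
  let J : Set G.ι := {e | D.graph.Joins e u w}
  have hJ : ∀ e ∈ J, G.arc e 1 = v ∧ G.arc e 0 = u ∧ D.W e = w := by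
    intro e he
    apply D.same_ends he₀
    rw [D.endpoints_inc he₀]
    exact (show D.graph.endpoints e = {u, w} from he).symm
  have hcont : ∀ e, Continuous (D.narc e) := D.graph.continuous_arc
  have hinj : ∀ e, Function.Injective (D.narc e) := D.graph.injective_arc
  have hrR := D.hrR
  have hd : ∀ i ∈ J, ∀ j ∈ J, i ≠ j → ∀ a b, D.narc i a = D.narc j b →
      (a = 0 ∧ b = 0) ∨ (a = 1 ∧ b = 1) := by
    intro i hi j hj hij a b hab
    obtain ⟨i1, i0, iW⟩ := hJ i hi
    obtain ⟨j1, j0, jW⟩ := hJ j hj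
    have E0 : D.narc i 0 = D.narc j 0 := by rw [D.narc_zero, D.narc_zero, i0, j0]
    have E1 : D.narc i 1 = D.narc j 1 := by rw [D.narc_one i1, D.narc_one j1, iW, jW]
    by_cases a0 : a = 0
    · subst a0
      exact Or.inl ⟨rfl, hinj j (hab.symm.trans E0)⟩
    by_cases a1 : a = 1
    · subst a1
      exact Or.inr ⟨rfl, hinj j (hab.symm.trans E1)⟩
    by_cases b0 : b = 0
    · subst b0
      exact Or.inl ⟨hinj i (hab.trans E0.symm), rfl⟩
    by_cases b1 : b = 1
    · subst b1
      exact Or.inr ⟨hinj i (hab.trans E1.symm), rfl⟩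
    exact absurd ⟨D.narc i a, ⟨a, ⟨a0, a1⟩, rfl⟩, ⟨b, ⟨b0, b1⟩, hab.symm⟩⟩ (hnc i j hi hj hij)
  obtain ⟨x0, hx0, hbd, htr⟩ := lens_transfer J J.toFinite G.arc D.narc D.s u v w D.R
    (fun i _ => G.continuous_arc i) (fun i _ => hcont i) (fun i _ => hinj i)
    (fun i hi => (hJ i hi).2.1) (fun i hi => (hJ i hi).1)
    (fun i hi => by rw [D.narc_one (hJ i hi).1, (hJ i hi).2.2])
    (D.far_zero e₀) ((D.hW e₀ he₀).trans hrR)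
    (fun i _ t ht => D.narc_le ht)
    (fun i hi t ht => D.hs4 i (hJ i hi).1 t ht)
    (fun i hi t ht => (D.narc_ge (hJ i hi).1 ht).trans_lt hrR)
    hd x hx hb
  set X := ⋃ i ∈ J, range (G.arc i) with hX
  have hsub : X ⊆ G.pairUnion u v := by
    intro z hz
    simp only [hX, mem_iUnion] at hz
    obtain ⟨i, hi, hz⟩ := hz
    refine mem_biUnion (x := i) ?_ hz
    change G.endpoints i = {u, v}
    rw [endpoints_old (hJ i hi).1, (hJ i hi).2.1]
  have hopen : IsOpen (connectedComponentIn Xᶜ x0) :=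
    ((closed_union G.arc G.continuous_arc J).isOpen_compl).connectedComponentIn
  have hne : (connectedComponentIn Xᶜ x0 ∩ (G.pairUnion u v)ᶜ).Nonempty := by
    by_contra hcon
    rw [not_nonempty_iff_eq_empty, ← disjoint_iff_inter_eq_empty,
      disjoint_compl_right_iff_subset] at hcon
    have h1 := interior_maximal hcon hopen
    have h2 : interior (G.pairUnion u v) = ∅ :=
      arcs_interior_empty _ (toFinite _) G.arc G.continuous_arc G.injective_arc
    rw [h2] at h1
    exact h1 (mem_connectedComponentIn hx0)
  obtain ⟨x1, hx1, hx1P⟩ := hne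
  have hC1 : connectedComponentIn (G.pairUnion u v)ᶜ x1 ⊆ connectedComponentIn Xᶜ x0 := by
    rw [connectedComponentIn_eq hx1]
    exact connectedComponentIn_mono _ (compl_subset_compl.2 hsub)
  have hj₀ : G.Joins e₀ u v := endpoints_old he₀
  obtain ⟨y, hyV, hy⟩ := hsep.2 (connectedComponentIn (G.pairUnion u v)ᶜ x1)
    ⟨u, v, D.hnorm e₀, ⟨e₀, hj₀⟩,
      fun e f he hf hef => hsep.1 e f ⟨hef, he.trans hf.symm⟩, hbd.subset hC1, x1, hx1P, rfl⟩
  have hyP : y ∉ G.pairUnion u v := connectedComponentIn_subset _ _ hy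
  have hyv : y ≠ v := by
    rintro rfl
    exact hyP (mem_biUnion (x := e₀) hj₀ ⟨1, he₀⟩)
  have hyR := D.hV y hyV hyv
  refine ⟨y, D.hVV y hyV hyv, htr y hyR.le ?_ (hC1 hy)⟩
  intro hmem
  simp only [mem_iUnion] at hmem
  obtain ⟨i, hi, t, ht⟩ := hmem
  rcases le_or_gt t (D.s i) with hts | hts
  · rw [D.narc_le hts] at ht
    exact hyP (hsub (mem_biUnion hi ⟨t, ht⟩))
  · have := D.narc_ge (hJ i hi).1 hts.le
    rw [ht] at this
    linarith

theorem separated (hsep : G.Separated) : D.graph.Separated := by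
  refine ⟨fun e f h hc => hsep.1 e f (D.parallel h) ((D.cross_iff h.1).1 hc), ?_⟩
  rintro ℓ ⟨u₁, v₁, hne, ⟨e₁, he₁⟩, hnc, hb, x, hx, rfl⟩
  by_cases hinc : ∃ e₀ : G.ι, G.arc e₀ 1 = v ∧ D.graph.Joins e₀ u₁ v₁
  · obtain ⟨e₀, he₀, hj⟩ := hinc
    have hset : ({u₁, v₁} : Set (ℝ × ℝ)) = {G.arc e₀ 0, D.W e₀} :=
      (show D.graph.endpoints e₀ = {u₁, v₁} from hj).symm.trans (D.endpoints_inc he₀)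
    have hJ : ∀ e : G.ι, D.graph.Joins e u₁ v₁ ↔ D.graph.Joins e (G.arc e₀ 0) (D.W e₀) := by
      intro e
      unfold TopMultigraph.Joins
      rw [hset]
    have hP : D.graph.pairUnion u₁ v₁ = D.graph.pairUnion (G.arc e₀ 0) (D.W e₀) := by
      unfold TopMultigraph.pairUnion TopMultigraph.Joins
      rw [hset]
    rw [hP] at hx hb ⊢
    exact D.lens_caseB hsep he₀ (fun e f he hf => hnc e f ((hJ e).2 he) ((hJ f).2 hf)) hx hb
  · push Not at hinc
    have hn₁ : G.arc e₁ 1 ≠ v := fun h => hinc e₁ h he₁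
    have he₁' : G.endpoints e₁ = {u₁, v₁} := (D.endpoints_not hn₁).symm.trans he₁
    have hvn : v ∉ ({u₁, v₁} : Set (ℝ × ℝ)) := by
      rw [← he₁']
      rintro (h | h)
      · exact D.hnorm e₁ h.symm
      · exact hn₁ (show v = _ from h).symm
    have hJ : ∀ e : G.ι, G.Joins e u₁ v₁ → G.arc e 1 ≠ v := by
      intro e he h
      apply hvn
      rw [← (show G.endpoints e = {u₁, v₁} from he), endpoints_old h]
      simp
    have hJ2 : ∀ e : G.ι, D.graph.Joins e u₁ v₁ ↔ G.Joins e u₁ v₁ := by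
      intro e
      constructor
      · intro he
        have hn : G.arc e 1 ≠ v := fun h => hinc e h he
        exact (D.endpoints_not hn).symm.trans he
      · intro he
        exact (D.endpoints_not (hJ e he)).trans he
    have hP : D.graph.pairUnion u₁ v₁ = G.pairUnion u₁ v₁ := by
      ext z
      unfold TopMultigraph.pairUnion
      simp only [mem_iUnion]
      constructor
      · rintro ⟨e, he, t, ht⟩
        have he' := (hJ2 e).1 he
        exact ⟨e, he', t, by rw [← D.narc_not (hJ e he')]; exact ht⟩
      · rintro ⟨e, he, t, ht⟩
        exact ⟨e, (hJ2 e).2 he, t, by rw [← ht, ← D.narc_not (hJ e he)]; rfl⟩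
    rw [hP] at hx hb ⊢
    obtain ⟨y, hyV, hy⟩ := hsep.2 _ ⟨u₁, v₁, hne, ⟨e₁, he₁'⟩,
      fun e f he hf hef => hsep.1 e f ⟨hef, he.trans hf.symm⟩, hb, x, hx, rfl⟩
    by_cases hyv : y = v
    · subst hyv
      obtain ⟨w, hw, hwr⟩ := D.hex
      refine ⟨w, hw, ?_⟩
      rw [connectedComponentIn_eq hy]
      refine (convex_disc y D.R).isPreconnected.subset_connectedComponentIn ?_ ?_
        (hwr.trans D.hrR)
      · simpa using D.hr.trans D.hrR
      · intro z hz hzP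
        unfold TopMultigraph.pairUnion at hzP
        simp only [mem_iUnion] at hzP
        obtain ⟨e, he, t, ht⟩ := hzP
        have := D.harc e (hJ e he) t
        rw [ht] at this
        exact lt_asymm this hz
    · exact ⟨y, D.hVV y hyV hyv, hy⟩

end SplitData

end SplitAux


namespace SplitAux

theorem upper_part (S : Finset ℝ) : ∀ k ≤ S.card, ∃ hi ⊆ S, hi.card = k ∧
    ∀ x ∈ S \ hi, ∀ y ∈ hi, x < y := by
  induction S using Finset.induction_on_max with
  | empty =>
    intro k hk
    exact ⟨∅, by simp, by simp at hk ⊢; omega, by simp⟩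
  | insert a S hmax ih =>
    have ha : a ∉ S := fun h => lt_irrefl _ (hmax a h)
    intro k hk
    rcases k with _ | k
    · exact ⟨∅, by simp, by simp, by simp⟩
    · rw [Finset.card_insert_of_notMem ha] at hk
      obtain ⟨hi, hsub, hcard, hlt⟩ := ih k (by omega)
      refine ⟨insert a hi, Finset.insert_subset_insert a hsub, ?_, ?_⟩
      · rw [Finset.card_insert_of_notMem fun h => ha (hsub h), hcard]
      · intro x hx y hy
        simp only [Finset.mem_sdiff, Finset.mem_insert, not_or] at hx hy
        have hxS : x ∈ S := hx.1.resolve_left hx.2.1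
        rcases hy with rfl | hy
        · exact hmax x hxS
        · exact hlt x (Finset.mem_sdiff.2 ⟨hxS, hx.2.2⟩) y hy

theorem threshold {κ : Type*} (I : Finset κ) (F : κ → ℝ) (hF : Set.InjOn F I) (k : ℕ)
    (hk : k ≤ I.card) : ∃ c : ℝ, (∀ e ∈ I, F e ≠ c) ∧ (I.filter (fun e => c < F e)).card = k := by
  classical
  obtain ⟨hi, hsub, hcard, hlt⟩ := upper_part (I.image F) k
    (by rwa [Finset.card_image_of_injOn hF])
  obtain ⟨c, hc1, hc2⟩ := Order.exists_between_finsets (I.image F \ hi) hi hlt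
  have hmem : ∀ e ∈ I, F e ∉ hi → F e < c := fun e he h =>
    hc1 _ (Finset.mem_sdiff.2 ⟨Finset.mem_image_of_mem F he, h⟩)
  refine ⟨c, ?_, ?_⟩
  · intro e he heq
    by_cases h : F e ∈ hi
    · exact (hc2 _ h).ne heq.symm
    · exact (hmem e he h).ne heq
  · rw [← hcard, ← Finset.card_image_of_injOn (f := F)
      (hF.mono (Finset.coe_subset.2 (Finset.filter_subset _ _)))]
    congr 1
    ext x
    simp only [Finset.mem_image, Finset.mem_filter]
    constructor
    · rintro ⟨e, ⟨he, hce⟩, rfl⟩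
      by_contra h
      exact lt_asymm hce (hmem e he h)
    · intro hx
      obtain ⟨e, he, rfl⟩ := Finset.mem_image.1 (hsub hx)
      exact ⟨e, ⟨he, hc2 _ hx⟩, rfl⟩

theorem generic {κ : Type*} (I : Finset κ) (p : κ → ℝ × ℝ) (hp : Set.InjOn p I) :
    ∃ a : ℝ, Set.InjOn (fun e => (p e).1 + a * (p e).2) I := by
  classical
  obtain ⟨a, ha⟩ := ((I ×ˢ I).image
    fun q => -((p q.1).1 - (p q.2).1) / ((p q.1).2 - (p q.2).2)).exists_notMem
  refine ⟨a, fun e he f hf hef => ?_⟩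
  simp only at hef
  apply hp he hf
  by_cases h2 : (p e).2 = (p f).2
  · apply Prod.ext _ h2
    rw [h2] at hef; linarith
  · exfalso
    apply ha
    refine Finset.mem_image.2 ⟨(e, f), Finset.mem_product.2 ⟨he, hf⟩, ?_⟩
    have : (p e).2 - (p f).2 ≠ 0 := sub_ne_zero.2 h2
    simp only
    rw [div_eq_iff this]
    linarith

theorem side_reroute {γ : unitInterval → ℝ × ℝ} {s t : unitInterval} {w : ℝ × ℝ} (α β c : ℝ)
    (hs : s < 1) (ht : s ≤ t) (h1 : c < α * (γ s).1 + β * (γ s).2) (h2 : c < α * w.1 + β * w.2) :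
    c < α * (reroute γ s w t).1 + β * (reroute γ s w t).2 := by
  rw [reroute_of_ge ht]
  obtain ⟨h3, h4, -, -⟩ := param_bounds hs ht
  generalize ((t : ℝ) - s) / (1 - s) = τ at *
  simp only [Prod.fst_add, Prod.smul_fst, Prod.fst_sub, smul_eq_mul, Prod.snd_add,
    Prod.smul_snd, Prod.snd_sub]
  have h5 := mul_nonneg (sub_nonneg.2 h4) (sub_nonneg.2 h1.le)
  rcases h3.eq_or_lt with h | h
  · rw [← h]; linarith
  · have h6 := mul_pos h (sub_pos.2 h2)
    linarith

theorem exists_side {v p : ℝ × ℝ} {r : ℝ} (hr : 0 < r) (hp : ‖cx p - cx v‖ = r) (α β c : ℝ)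
    (h : c < α * p.1 + β * p.2) : ∃ w, ‖cx w - cx v‖ < r ∧ c < α * w.1 + β * w.2 := by
  have hc : Continuous fun τ : ℝ => α * (p + τ • (v - p)).1 + β * (p + τ • (v - p)).2 := by
    fun_prop
  have hev : ∀ᶠ τ in nhds (0 : ℝ), c < α * (p + τ • (v - p)).1 + β * (p + τ • (v - p)).2 :=
    (hc.tendsto 0).eventually (lt_mem_nhds (by simpa using h))
  obtain ⟨δ, hδ, hb⟩ := Metric.eventually_nhds_iff.1 hev
  have hm : 0 < min (δ / 2) 1 := lt_min (by linarith) one_pos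
  refine ⟨p + (min (δ / 2) 1) • (v - p), norm_combo_lt hp (by simpa using hr) hm
    (min_le_right _ _), hb ?_⟩
  rw [Real.dist_eq, sub_zero, abs_of_pos hm]
  exact (min_le_left _ _).trans_lt (by linarith)

theorem split_normalised (G : TopMultigraph) (v : ℝ × ℝ) (hv : v ∈ G.V) (hsc : G.SingleCrossing)
    (hsep : G.Separated) (hnorm : ∀ e, G.arc e 0 ≠ v) (k : ℕ) (hk0 : 0 < k)
    (hk : k < G.degree v) :
    ∃ G' : TopMultigraph, G'.SingleCrossing ∧ G'.Separated ∧ G'.edgeCount = G.edgeCount ∧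
      G'.crossingNumber = G.crossingNumber ∧ ∃ w₁ w₂ : ℝ × ℝ, w₁ ≠ w₂ ∧ w₁ ∉ G.V.erase v ∧
      w₂ ∉ G.V.erase v ∧ G'.V = insert w₁ (insert w₂ (G.V.erase v)) ∧ G'.degree w₁ = k ∧
      G'.degree w₂ = G.degree v - k ∧ ∀ y ∈ G.V.erase v, G'.degree y = G.degree y := by
  classical
  obtain ⟨R, r, hr, hrR, s, hV, harc, hcross, hs⟩ := exists_discs G v hv hsc hnorm
  let I : Finset G.ι := Finset.univ.filter fun e => G.arc e 1 = v
  have hI : ∀ e, e ∈ I ↔ G.arc e 1 = v := fun e => by simp [I]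
  have hvend : ∀ e, v ∈ G.endpoints e ↔ G.arc e 1 = v := by
    intro e
    constructor
    · rintro (h | h)
      · exact absurd h.symm (hnorm e)
      · exact (show v = _ from h).symm
    · intro h; exact Or.inr h.symm
  have hdeg : G.degree v = I.card := by
    unfold TopMultigraph.degree
    rw [Nat.card_eq_fintype_card, Fintype.card_subtype]
    congr 1
    ext e
    simp [hI, hvend]
  let p : G.ι → ℝ × ℝ := fun e => G.arc e (s e)
  have hfar0 : ∀ e, R < ‖cx (G.arc e 0) - cx v‖ := fun e => hV _ (G.source_mem e) (hnorm e)
  have hp : Set.InjOn p I := by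
    intro e he f hf hef
    by_contra hne
    have hinterior : ∀ e ∈ I, p e ∈ G.arcInterior e := by
      intro e he
      have h := hs e ((hI e).1 he)
      refine ⟨s e, ⟨?_, h.1.ne⟩, rfl⟩
      intro h0
      have h1 := hfar0 e
      have h2 := h.2.2.1
      rw [h0] at h2
      linarith
    have h1 := hcross e f hne (p e) ⟨hinterior e he, by rw [hef]; exact hinterior f hf⟩
    have h2 := (hs e ((hI e).1 he)).2.2.1
    change R < ‖cx (G.arc e (s e)) - cx v‖ at h1
    linarith
  obtain ⟨a, ha⟩ := generic I p hp
  obtain ⟨c, hc, hck⟩ := threshold I _ ha k (by omega)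
  let F : G.ι → ℝ := fun e => (p e).1 + a * (p e).2
  have hhi : ∃ e ∈ I, c < F e := by
    have : (I.filter fun e => c < F e).Nonempty := by
      rw [← Finset.card_pos]
      change 0 < (I.filter (fun e => c < (p e).1 + a * (p e).2)).card
      omega
    obtain ⟨e, he⟩ := this
    exact ⟨e, (Finset.mem_filter.1 he).1, (Finset.mem_filter.1 he).2⟩
  have hsplit := Finset.card_filter_add_card_filter_not (s := I) (fun e => c < F e)
  change (I.filter (fun e => c < F e)).card = k at hck
  have hlo : ∃ e ∈ I, F e < c := by
    have : (I.filter fun e => ¬ c < F e).Nonempty := by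
      rw [← Finset.card_pos]
      omega
    obtain ⟨e, he⟩ := this
    have he' := Finset.mem_filter.1 he
    exact ⟨e, he'.1, lt_of_le_of_ne (not_lt.1 he'.2) (hc e he'.1)⟩
  obtain ⟨w₁, hw₁, hcw₁⟩ : ∃ w, ‖cx w - cx v‖ < r ∧ c < 1 * w.1 + a * w.2 := by
    obtain ⟨e, he, h⟩ := hhi
    exact exists_side hr (hs e ((hI e).1 he)).2.2.1 1 a c (by simpa [F, p] using h)
  obtain ⟨w₂, hw₂, hcw₂⟩ : ∃ w, ‖cx w - cx v‖ < r ∧ -c < (-1) * w.1 + (-a) * w.2 := by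
    obtain ⟨e, he, h⟩ := hlo
    refine exists_side hr (hs e ((hI e).1 he)).2.2.1 (-1) (-a) (-c) ?_
    simp only [F, p] at h
    linarith
  have hw12 : w₁ ≠ w₂ := by
    rintro rfl
    linarith
  have hnot : ∀ w, ‖cx w - cx v‖ < r → w ∉ G.V.erase v := by
    intro w hw hmem
    have := hV w (Finset.mem_of_mem_erase hmem) (Finset.ne_of_mem_erase hmem)
    linarith
  let W : G.ι → ℝ × ℝ := fun e => if c < F e then w₁ else w₂
  have hWhi : ∀ e, c < F e → W e = w₁ := fun e h => by simp [W, h]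
  have hWlo : ∀ e, ¬ c < F e → W e = w₂ := fun e h => by simp [W, h]
  have hWr : ∀ e, ‖cx (W e) - cx v‖ < r := by
    intro e
    by_cases h : c < F e
    · rw [hWhi e h]; exact hw₁
    · rw [hWlo e h]; exact hw₂
  have hside1 : ∀ e, G.arc e 1 = v → c < F e → ∀ t, s e ≤ t →
      c < 1 * (reroute (G.arc e) (s e) (W e) t).1 + a * (reroute (G.arc e) (s e) (W e) t).2 := by
    intro e he h t ht
    refine side_reroute 1 a c (hs e he).1 ht ?_ ?_
    · simpa [F, p] using h
    · rw [hWhi e h]; exact hcw₁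
  have hside2 : ∀ e, G.arc e 1 = v → ¬ c < F e → ∀ t, s e ≤ t →
      -c < (-1) * (reroute (G.arc e) (s e) (W e) t).1
        + (-a) * (reroute (G.arc e) (s e) (W e) t).2 := by
    intro e he h t ht
    refine side_reroute (-1) (-a) (-c) (hs e he).1 ht ?_ ?_
    · have := lt_of_le_of_ne (not_lt.1 h) (hc e ((hI e).2 he))
      simp only [F, p] at this
      linarith
    · rw [hWlo e h]; exact hcw₂
  let D : SplitData G v :=
    { R := R, r := r, s := s, W := W, V' := insert w₁ (insert w₂ (G.V.erase v))
      hr := hr, hrR := hrR, hnorm := hnorm, hV := hV, harc := harc, hcross := hcross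
      hs1 := fun e he => (hs e he).1
      hs2 := fun e he => (hs e he).2.1
      hs3 := fun e he => (hs e he).2.2.1
      hs4 := fun e he => (hs e he).2.2.2
      hW := fun e _ => hWr e
      hWV := by
        intro e _
        by_cases h : c < F e
        · rw [hWhi e h]; simp
        · rw [hWlo e h]; simp
      hVV := by
        intro y hy hyv
        simp [hy, hyv]
      hVV2 := by
        intro y hy
        simp only [Finset.mem_insert, Finset.mem_erase] at hy
        rcases hy with rfl | rfl | hy
        · exact Or.inr hw₁
        · exact Or.inr hw₂
        · exact Or.inl ⟨hy.2, hy.1⟩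
      hex := ⟨w₁, by simp, hw₁⟩
      hav := by
        intro e he t ht ht1 hmem
        have hinj := reroute_injective (G.injective_arc e) (hs e he).1 (hs e he).2.2.1 (hWr e)
          (hs e he).2.1
        have hnW : reroute (G.arc e) (s e) (W e) t ≠ W e := by
          intro h
          apply ht1
          apply hinj
          rw [h, reroute_one (hs e he).1]
        have hN : ‖cx (reroute (G.arc e) (s e) (W e) t) - cx v‖ ≤ r := by
          rcases ht.eq_or_lt with h | h
          · rw [← h, reroute_of_le le_rfl]; exact (hs e he).2.2.1.le
          · exact (reroute_norm_lt (hs e he).1 (hs e he).2.2.1 (hWr e) h).le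
        simp only [Finset.mem_insert] at hmem
        rcases hmem with h | h | h
        · by_cases hF : c < F e
          · rw [hWhi e hF] at h hnW; exact hnW h
          · have := hside2 e he hF t ht
            rw [h] at this; linarith
        · by_cases hF : c < F e
          · have := hside1 e he hF t ht
            rw [h] at this; linarith
          · rw [hWlo e hF] at h hnW; exact hnW h
        · have := hV _ (Finset.mem_of_mem_erase h) (Finset.ne_of_mem_erase h)
          linarith
      hdis := by
        intro e f he hf hef x y hx hy hxy
        have hsame : W e = W f → x = 1 ∧ y = 1 := by
          intro hWW
          rw [reroute_of_ge hx, reroute_of_ge hy, ← hWW] at hxy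
          have b1 := param_bounds (hs e he).1 hx
          have b2 := param_bounds (hs f hf).1 hy
          have := segments_meet (hs e he).2.2.1 (hs f hf).2.2.1 (hWr e)
            (fun h => hef (hp ((hI e).2 he) ((hI f).2 hf) h)) b1.1 b1.2.1 b2.1 b2.2.1 hxy
          exact ⟨b1.2.2.2 this.1, b2.2.2.2 this.2⟩
        by_cases h1 : c < F e <;> by_cases h2 : c < F f
        · exact hsame ((hWhi e h1).trans (hWhi f h2).symm)
        · have i1 := hside1 e he h1 x hx
          have i2 := hside2 f hf h2 y hy
          rw [hxy] at i1; linarith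
        · have i1 := hside2 e he h1 x hx
          have i2 := hside1 f hf h2 y hy
          rw [hxy] at i1; linarith
        · exact hsame ((hWlo e h1).trans (hWlo f h2).symm) }
  have hendW : ∀ w, ‖cx w - cx v‖ < r → ∀ e : G.ι,
      w ∈ D.graph.endpoints e ↔ (G.arc e 1 = v ∧ W e = w) := by
    intro w hw e
    by_cases he : G.arc e 1 = v
    · rw [D.endpoints_inc he]
      constructor
      · rintro (h | h)
        · have := hfar0 e
          rw [← h] at this; linarith
        · exact ⟨he, (show w = W e from h).symm⟩
      · rintro ⟨-, h⟩
        exact Or.inr h.symm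
    · rw [D.endpoints_not he]
      constructor
      · rintro (h | h)
        · have := hfar0 e
          rw [← h] at this; linarith
        · have := harc e he 1
          rw [← (show w = _ from h)] at this; linarith
      · exact fun h => absurd h.1 he
  have hdegW : ∀ w, ‖cx w - cx v‖ < r →
      D.graph.degree w = (I.filter fun e => W e = w).card := by
    intro w hw
    unfold TopMultigraph.degree
    change Nat.card {e : G.ι // w ∈ D.graph.endpoints e} = _
    rw [Nat.card_congr (Equiv.subtypeEquivRight (hendW w hw)), Nat.card_eq_fintype_card,
      Fintype.card_subtype]
    congr 1
    ext e
    simp [hI]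
  refine ⟨D.graph, D.singleCrossing hsc, D.separated hsep, rfl, D.crossingNumber_eq, w₁, w₂, hw12,
    hnot _ hw₁, hnot _ hw₂, rfl, ?_, ?_, ?_⟩
  · rw [hdegW w₁ hw₁, ← hck]
    congr 1
    apply Finset.filter_congr
    intro e _
    by_cases h : c < F e
    · simp [hWhi e h, h]
    · simp [hWlo e h, h, hw12.symm]
  · rw [hdegW w₂ hw₂, hdeg, ← hck]
    rw [← hsplit, Nat.add_sub_cancel_left]
    congr 1
    apply Finset.filter_congr
    intro e _
    by_cases h : c < F e
    · simp [hWhi e h, h, hw12]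
    · simp [hWlo e h, h]
  · intro y hy
    have hyR := hV y (Finset.mem_of_mem_erase hy) (Finset.ne_of_mem_erase hy)
    unfold TopMultigraph.degree
    change Nat.card {e : G.ι // y ∈ D.graph.endpoints e} = _
    refine Nat.card_congr (Equiv.subtypeEquivRight fun e => ?_)
    by_cases he : G.arc e 1 = v
    · rw [D.endpoints_inc he, SplitData.endpoints_old he]
      have h1 : y ≠ W e := by
        intro h
        have := hWr e
        rw [← h] at this; linarith
      have h2 : y ≠ v := Finset.ne_of_mem_erase hy
      change y ∈ ({G.arc e 0, W e} : Set (ℝ × ℝ)) ↔ _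
      simp [h1, h2]
    · rw [D.endpoints_not he]

/-- Reverse those arcs which start at `v`. -/
noncomputable def flip (G : TopMultigraph) (v : ℝ × ℝ) : TopMultigraph :=
  open Classical in
  { V := G.V
    ι := G.ι
    fintype_ι := G.fintype_ι
    arc := fun e => if G.arc e 0 = v then fun t => G.arc e (unitInterval.symm t) else G.arc e
    continuous_arc := by
      intro e
      split_ifs
      · exact (G.continuous_arc e).comp unitInterval.continuous_symm
      · exact G.continuous_arc e
    injective_arc := by
      intro e
      split_ifs
      · exact (G.injective_arc e).comp unitInterval.symm_bijective.injective
      · exact G.injective_arc e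
    source_mem := by
      intro e
      split_ifs
      · simpa using G.target_mem e
      · exact G.source_mem e
    target_mem := by
      intro e
      split_ifs
      · simpa using G.source_mem e
      · exact G.target_mem e
    ends_ne := by
      intro e
      split_ifs
      · simpa using (G.ends_ne e).symm
      · exact G.ends_ne e
    interior_avoids := by
      intro e t h0 h1
      split_ifs
      · exact G.interior_avoids e _ (by simpa [unitInterval.symm_eq_zero] using h1)
          (by simpa [unitInterval.symm_eq_one] using h0)
      · exact G.interior_avoids e t h0 h1 }

theorem flip_arc (G : TopMultigraph) (v : ℝ × ℝ) (e : G.ι) :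
    (flip G v).arc e = G.arc e ∨
      (G.arc e 0 = v ∧ (flip G v).arc e = fun t => G.arc e (unitInterval.symm t)) := by
  by_cases h : G.arc e 0 = v
  · exact Or.inr ⟨h, by simp [flip, h]⟩
  · exact Or.inl (by simp [flip, h])

theorem flip_norm (G : TopMultigraph) (v : ℝ × ℝ) (e : G.ι) : (flip G v).arc e 0 ≠ v := by
  by_cases h : G.arc e 0 = v
  · have : (flip G v).arc e 0 = G.arc e 1 := by simp [flip, h]
    rw [this, ← h]
    exact (G.ends_ne e).symm
  · have : (flip G v).arc e 0 = G.arc e 0 := by simp [flip, h]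
    rwa [this]

theorem flip_interior (G : TopMultigraph) (v : ℝ × ℝ) :
    (flip G v).arcInterior = G.arcInterior := by
  funext e
  rcases flip_arc G v e with h | ⟨-, h⟩
  · unfold TopMultigraph.arcInterior; rw [h]
  · unfold TopMultigraph.arcInterior
    rw [h]
    ext z
    constructor
    · rintro ⟨t, ⟨h0, h1⟩, rfl⟩
      exact ⟨unitInterval.symm t, ⟨by simpa [unitInterval.symm_eq_zero] using h1,
        by simpa [unitInterval.symm_eq_one] using h0⟩, rfl⟩
    · rintro ⟨t, ⟨h0, h1⟩, rfl⟩
      exact ⟨unitInterval.symm t, ⟨by simpa [unitInterval.symm_eq_zero] using h1,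
        by simpa [unitInterval.symm_eq_one] using h0⟩, by simp⟩

theorem flip_endpoints (G : TopMultigraph) (v : ℝ × ℝ) :
    (flip G v).endpoints = G.endpoints := by
  funext e
  rcases flip_arc G v e with h | ⟨-, h⟩
  · unfold TopMultigraph.endpoints; rw [h]
  · unfold TopMultigraph.endpoints
    rw [h]
    simp [Set.pair_comm]

theorem flip_range (G : TopMultigraph) (v : ℝ × ℝ) (e : G.ι) :
    range ((flip G v).arc e) = range (G.arc e) := by
  rcases flip_arc G v e with h | ⟨-, h⟩
  · rw [h]
  · rw [h]
    exact unitInterval.symm_bijective.surjective.range_comp (G.arc e)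

theorem flip_cross (G : TopMultigraph) (v : ℝ × ℝ) : (flip G v).Cross = G.Cross := by
  unfold TopMultigraph.Cross
  rw [flip_interior]
  rfl

theorem flip_joins (G : TopMultigraph) (v : ℝ × ℝ) : (flip G v).Joins = G.Joins := by
  unfold TopMultigraph.Joins
  rw [flip_endpoints]
  rfl

theorem flip_pairUnion (G : TopMultigraph) (v : ℝ × ℝ) :
    (flip G v).pairUnion = G.pairUnion := by
  funext a b
  unfold TopMultigraph.pairUnion
  rw [flip_joins]
  exact iUnion_congr fun e => iUnion_congr fun _ => flip_range G v e

theorem flip_separated (G : TopMultigraph) (v : ℝ × ℝ) (h : G.Separated) :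
    (flip G v).Separated := by
  refine ⟨fun e f hef => ?_, ?_⟩
  · rw [flip_cross]
    refine h.1 e f ⟨hef.1, ?_⟩
    have := hef.2
    rwa [flip_endpoints] at this
  · rintro ℓ ⟨a, b, hl⟩
    refine h.2 ℓ ⟨a, b, ?_⟩
    unfold TopMultigraph.IsLensAt at hl
    rwa [flip_pairUnion, flip_joins, flip_cross] at hl

theorem split_vertex (G : TopMultigraph) (v : ℝ × ℝ) (hv : v ∈ G.V) (hsc : G.SingleCrossing)
    (hsep : G.Separated) (k : ℕ) (hk0 : 0 < k) (hk : k < G.degree v) :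
    ∃ G' : TopMultigraph, G'.SingleCrossing ∧ G'.Separated ∧ G'.edgeCount = G.edgeCount ∧
      G'.crossingNumber = G.crossingNumber ∧ ∃ w₁ w₂ : ℝ × ℝ, w₁ ≠ w₂ ∧ w₁ ∉ G.V.erase v ∧
      w₂ ∉ G.V.erase v ∧ G'.V = insert w₁ (insert w₂ (G.V.erase v)) ∧ G'.degree w₁ = k ∧
      G'.degree w₂ = G.degree v - k ∧ ∀ y ∈ G.V.erase v, G'.degree y = G.degree y := by
  have hdeg : (flip G v).degree = G.degree := by
    unfold TopMultigraph.degree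
    rw [flip_endpoints]
    rfl
  have hcn : (flip G v).crossingNumber = G.crossingNumber := by
    unfold TopMultigraph.crossingNumber
    rw [flip_cross]
    rfl
  have hsc' : (flip G v).SingleCrossing := by
    unfold TopMultigraph.SingleCrossing
    rw [flip_interior]
    exact hsc
  have := split_normalised (flip G v) v hv hsc' (flip_separated G v hsep) (flip_norm G v) k hk0
    (by rwa [hdeg])
  rwa [hdeg, hcn] at this

end SplitAux


namespace SplitAux

theorem reduce (Δ : ℕ) (hΔ : 0 < Δ) : ∀ (m : ℕ) (G : TopMultigraph), G.SingleCrossing →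
    G.Separated → ∑ v ∈ G.V, (G.degree v - 1) / Δ = m →
    ∃ G' : TopMultigraph, G'.SingleCrossing ∧ G'.Separated ∧ G'.V.card ≤ G.V.card + m ∧
      G'.edgeCount = G.edgeCount ∧ G'.crossingNumber = G.crossingNumber ∧
      ∀ v ∈ G'.V, G'.degree v ≤ Δ := by
  intro m
  induction m with
  | zero =>
    intro G hsc hsep hm
    refine ⟨G, hsc, hsep, by omega, rfl, rfl, fun v hv => ?_⟩
    have h := Finset.sum_eq_zero_iff.1 hm v hv
    rw [Nat.div_eq_zero_iff] at h
    omega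
  | succ m ih =>
    intro G hsc hsep hm
    by_cases hall : ∀ v ∈ G.V, G.degree v ≤ Δ
    · exact ⟨G, hsc, hsep, by omega, rfl, rfl, hall⟩
    push Not at hall
    obtain ⟨v, hv, hd⟩ := hall
    obtain ⟨G₁, hsc₁, hsep₁, he₁, hc₁, w₁, w₂, hne, hw₁, hw₂, hV, hd₁, hd₂, hdo⟩ :=
      split_vertex G v hv hsc hsep Δ hΔ hd
    have hw₁' : w₁ ∉ insert w₂ (G.V.erase v) := by
      rw [Finset.mem_insert, not_or]; exact ⟨hne, hw₁⟩
    have hcard : G₁.V.card = G.V.card + 1 := by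
      rw [hV, Finset.card_insert_of_notMem hw₁', Finset.card_insert_of_notMem hw₂,
        Finset.card_erase_add_one hv]
    have hsum : ∑ y ∈ G₁.V, (G₁.degree y - 1) / Δ = m := by
      rw [hV, Finset.sum_insert hw₁', Finset.sum_insert hw₂, hd₁, hd₂]
      rw [Finset.sum_congr rfl fun y hy => by rw [hdo y hy]]
      rw [← Finset.add_sum_erase _ _ hv] at hm
      have h1 : (Δ - 1) / Δ = 0 := Nat.div_eq_of_lt (by omega)
      have h2 : (G.degree v - 1) / Δ = (G.degree v - Δ - 1) / Δ + 1 := by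
        rw [← Nat.add_div_right _ hΔ]
        congr 1
        omega
      omega
    obtain ⟨G', h1, h2, h3, h4, h5, h6⟩ := ih G₁ hsc₁ hsep₁ hsum
    exact ⟨G', h1, h2, by omega, h4.trans he₁, h5.trans hc₁, h6⟩

theorem handshake (G : TopMultigraph) : ∑ v ∈ G.V, G.degree v ≤ 2 * G.edgeCount := by
  classical
  have h1 : ∀ v, G.degree v = ∑ e : G.ι, if v ∈ G.endpoints e then 1 else 0 := by
    intro v
    unfold TopMultigraph.degree
    rw [Nat.card_eq_fintype_card, Fintype.card_subtype, Finset.card_filter]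
  rw [Finset.sum_congr rfl fun v _ => h1 v, Finset.sum_comm]
  have h2 : ∀ e : G.ι, (∑ v ∈ G.V, if v ∈ G.endpoints e then 1 else 0) ≤ 2 := by
    intro e
    rw [← Finset.card_filter]
    refine (Finset.card_le_card (t := {G.arc e 0, G.arc e 1}) ?_).trans Finset.card_le_two
    intro v hv
    have := (Finset.mem_filter.1 hv).2
    simpa [TopMultigraph.endpoints] using this
  refine (Finset.sum_le_sum fun e _ => h2 e).trans ?_
  unfold TopMultigraph.edgeCount
  rw [Nat.card_eq_fintype_card]
  simp [mul_comm]

theorem degree_le_edgeCount (G : TopMultigraph) (v : ℝ × ℝ) : G.degree v ≤ G.edgeCount :=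
  Nat.card_le_card_of_injective _ Subtype.val_injective

end SplitAux

/-- **Vertex splitting.** For every separated single-crossing topological multigraph `G` on
`n ≥ 1` vertices with `e` edges and `Δ = ⌈2e/n⌉`, there is a separated single-crossing
topological multigraph `G'` with at most `2n` vertices, exactly `e` edges, the same crossing
number, and maximum degree at most `Δ`. -/
theorem exists_split_bounded_degree (G : TopMultigraph) (hn : 1 ≤ G.V.card)
    (hsc : G.SingleCrossing) (hsep : G.Separated) :
    ∃ G' : TopMultigraph, G'.SingleCrossing ∧ G'.Separated ∧
      G'.V.card ≤ 2 * G.V.card ∧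
      G'.edgeCount = G.edgeCount ∧
      G'.crossingNumber = G.crossingNumber ∧
      ∀ v ∈ G'.V, G'.degree v ≤ ⌈(2 * G.edgeCount : ℝ) / (G.V.card : ℝ)⌉₊ := by
  have hnpos : (0 : ℝ) < G.V.card := by exact_mod_cast hn
  have hceil := Nat.le_ceil ((2 * G.edgeCount : ℝ) / (G.V.card : ℝ))
  generalize ⌈(2 * G.edgeCount : ℝ) / (G.V.card : ℝ)⌉₊ = Δ at *
  rw [div_le_iff₀ hnpos] at hceil
  have hle : 2 * G.edgeCount ≤ Δ * G.V.card := by exact_mod_cast hceil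
  rcases Nat.eq_zero_or_pos Δ with rfl | hΔ
  · refine ⟨G, hsc, hsep, by omega, rfl, rfl, fun v _ => ?_⟩
    have := SplitAux.degree_le_edgeCount G v
    omega
  · obtain ⟨G', h1, h2, h3, h4, h5, h6⟩ := SplitAux.reduce Δ hΔ _ G hsc hsep rfl
    refine ⟨G', h1, h2, ?_, h4, h5, h6⟩
    have hs : Δ * ∑ v ∈ G.V, (G.degree v - 1) / Δ ≤ Δ * G.V.card := by
      rw [Finset.mul_sum]
      refine (Finset.sum_le_sum fun v _ => ?_).trans ((SplitAux.handshake G).trans hle)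
      exact (Nat.mul_div_le _ _).trans (Nat.sub_le _ _)
    have := Nat.le_of_mul_le_mul_left hs hΔ
    omega
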